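/- arXiv:1906.04575 — 4 statements merged into one kernel-verified Lean document; each statement's English description precedes it below -/
import Mathlib

section
/- Fix integers r ≥ 2 and k with 3 ≤ k ≤ 2r − 1. There exist constants c_1, c_2 > 0 (depending only on k and r) such that c_1 · n^{r−1} ≤ ex_↻(n, P_k^r) ≤ c_2 · n^{r−1} for all n ≥ 2r + 1. -/
/-- `CycChain ℓ w` says that starting at `w 0` and moving clockwise around the cyclically
ordered set `Fin n` (clockwise = increasing residues), one encounters
`w 1, w 2, ..., w (ℓ-1)` in this order, i.e. `w 0 < w 1 < ... < w (ℓ-1) (< w 0)`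
in the cyclic order. -/
def CycChain {n : ℕ} (ℓ : ℕ) (w : ℕ → Fin n) : Prop :=
  ∀ i j : ℕ, i < j → j < ℓ → w i - w 0 < w j - w 0

/-- `IsCycCrossPath r k H v` says that `v 0, v 1, ..., v (k+r-2)` are distinct vertices forming
an `r`-uniform crossing `k`-path in the convex geometric `r`-graph `H` on the cyclically ordered
vertex set `Fin n`: the edges are `{v i, ..., v (i+r-1)}` for `0 ≤ i ≤ k-1`, and in the cyclic
order:
(i) `v 0 < v 1 < ... < v (r-1)`;
(ii) for each `j < r-1`, `v j < v (j+r) < v (j+2r) < ... < v (j+1)`, the chain running over all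
indices `j + i*r ≤ k+r-2`;
(iii) `v 0 < v (r-1) < v (2r-1) < ... < v (⌊(r+k-2)/r⌋*r - 1)`. -/
def IsCycCrossPath (r k : ℕ) {n : ℕ} (H : Finset (Finset (Fin n))) (v : ℕ → Fin n) : Prop :=
  (∀ i j : ℕ, i < k + r - 1 → j < k + r - 1 → v i = v j → i = j) ∧
  (∀ i : ℕ, i < k → Finset.image v (Finset.Ico i (i + r)) ∈ H) ∧
  CycChain r v ∧
  (∀ j : ℕ, j + 1 < r →
    CycChain ((k + r - 2 - j) / r + 2)
      (fun i => if i = 0 then v j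
                else if i ≤ (k + r - 2 - j) / r then v (j + i * r) else v (j + 1))) ∧
  CycChain ((k + r - 2) / r + 1) (fun i => if i = 0 then v 0 else v (i * r - 1))

/-- `exCycP n r k` is the maximum number of edges in an `n`-vertex convex geometric `r`-graph
containing no crossing `k`-path `P_k^r`. -/
noncomputable def exCycP (n r k : ℕ) : ℕ :=
  sSup {m | ∃ H : Finset (Finset (Fin n)),
    (∀ e ∈ H, e.card = r) ∧ (¬ ∃ v : ℕ → Fin n, IsCycCrossPath r k H v) ∧ H.card = m}

namespace CrossingPath

open Finset Classical

/-- Integer lifts of `r`-subsets of a cyclically ordered `n`-set: increasing sequences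
`a 0 < ⋯ < a (r-1) < a 0 + n` in `[0, 2n)`, extended by zero. -/
structure IsLift (r : ℕ) (n : ℤ) (a : ℕ → ℤ) : Prop where
  eq_zero : ∀ i, r ≤ i → a i = 0
  nonneg : ∀ i, i < r → 0 ≤ a i
  lt_two_mul : ∀ i, i < r → a i < 2 * n
  lt_succ : ∀ i, i + 1 < r → a i < a (i + 1)
  last_lt : a (r - 1) < a 0 + n

/-- The outer gap of `a` is at most each of the inner gaps from the `j`-th one on. -/
def OuterGapLe (r : ℕ) (n : ℤ) (j : ℕ) (a : ℕ → ℤ) : Prop :=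
  ∀ i, j ≤ i → i + 1 < r → a 0 + n - a (r - 1) ≤ a (i + 1) - a i

/-- The entries `a j, …, a (r-2)` can be moved up one after the other, each by less than half of
the gap above it, while staying in `L`. -/
def MovesUp (r : ℕ) (L : Set (ℕ → ℤ)) (j : ℕ) (a : ℕ → ℤ) : Prop :=
  ∃ x : ℕ → ℤ, (∀ i, j ≤ i → i + 1 < r → a i < x i ∧ 2 * (x i - a i) < a (i + 1) - a i) ∧
    ∀ s, j ≤ s → s < r → (fun i => if j ≤ i ∧ i < s then x i else a i) ∈ L

lemma movesUp_last {r : ℕ} {L : Set (ℕ → ℤ)} {a : ℕ → ℤ} (ha : a ∈ L) :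
    MovesUp r L (r - 1) a := by
  refine ⟨a, fun i h1 h2 => by omega, fun s _ _ => ?_⟩
  simpa using ha

lemma MovesUp.step {r : ℕ} {L : Set (ℕ → ℤ)} {a : ℕ → ℤ} {j : ℕ} {y : ℤ} (ha : a ∈ L)
    (h1 : a j < y) (h2 : 2 * (y - a j) < a (j + 1) - a j)
    (h : MovesUp r L (j + 1) (Function.update a j y)) : MovesUp r L j a := by
  obtain ⟨x, hx, hs⟩ := h
  refine ⟨Function.update x j y, fun i hi hir => ?_, fun s hjs hsr => ?_⟩
  · rcases hi.eq_or_lt with rfl | hlt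
    · simpa using ⟨h1, h2⟩
    · have := hx i hlt hir
      rwa [Function.update_of_ne (by omega), Function.update_of_ne (by omega)] at *
  · rcases hjs.eq_or_lt with rfl | hlt
    · convert ha using 2 with i
      rw [if_neg (by omega)]
    · convert hs s hlt hsr using 2 with i
      rcases eq_or_ne i j with rfl | hne
      · simp [hlt]
      · simp only [Function.update_of_ne hne]
        congr 1
        apply propext
        omega

lemma card_le_pow_of_injOn_code {r m : ℕ} {j : ℕ} (hj : j < r) (S : Finset (ℕ → ℤ))
    (f : (ℕ → ℤ) → ℕ → ℤ) (h0 : ∀ a ∈ S, f a j = 0)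
    (hf : ∀ a ∈ S, ∀ i, i < r → 0 ≤ f a i ∧ f a i < m)
    (hinj : ∀ a ∈ S, ∀ b ∈ S, (∀ i, i < r → f a i = f b i) → a = b) :
    S.card ≤ m ^ (r - 1) := by
  have := Finset.card_le_card_of_injOn (s := S)
    (t := Fintype.piFinset fun i : Fin r => if i = ⟨j, hj⟩ then {0} else Finset.Ico (0 : ℤ) m)
    (fun a i => f a i) (by
      intro a ha
      rw [mem_coe, Fintype.mem_piFinset]
      intro i
      split_ifs with h
      · simp [h, h0 a ha]
      · simpa using hf a ha i i.2)
    (by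
      intro a ha b hb hab
      exact hinj a ha b hb fun i hi => congrFun hab ⟨i, hi⟩)
  refine this.trans_eq ?_
  rw [Fintype.card_piFinset, ← Finset.mul_prod_erase _ _ (mem_univ ⟨j, hj⟩)]
  rw [Finset.prod_congr rfl (g := fun _ => m)]
  · simp
  · intro i hi
    simp [ne_of_mem_erase hi]

/-- Binary codes: `2 ^ (l + 1) + g` with `0 ≤ g < 2 ^ (l + 1)` determines `l`. -/
lemma level_le_of_code_eq {l l' : ℕ} {g g' : ℤ} (hg : g < 2 ^ (l + 1)) (hg' : 0 ≤ g')
    (h : 2 ^ (l + 1) + g = 2 ^ (l' + 1) + g') : l' ≤ l := by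
  by_contra! hlt
  have : (2 : ℤ) ^ (l + 2) ≤ 2 ^ (l' + 1) := pow_le_pow_right₀ (by norm_num) (by omega)
  have h2 : (2 : ℤ) ^ (l + 2) = 2 * 2 ^ (l + 1) := by ring
  linarith

lemma IsLift.eq_of_forall_lt {r : ℕ} {n : ℤ} {a b : ℕ → ℤ} (ha : IsLift r n a) (hb : IsLift r n b)
    (h : ∀ i, i < r → a i = b i) : a = b := by
  funext i
  rcases lt_or_ge i r with hi | hi
  · exact h i hi
  · rw [ha.eq_zero i hi, hb.eq_zero i hi]

lemma card_stuck_zero_le {r n : ℕ} (hr : 2 ≤ r) (L : Finset (ℕ → ℤ))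
    (hL : ∀ a ∈ L, IsLift r n a) :
    #{a ∈ L | OuterGapLe r n 0 a ∧ ¬ MovesUp r L 0 a ∧ MovesUp r L 1 a} ≤ (8 * n) ^ (r - 1) := by
  refine card_le_pow_of_injOn_code (j := 0) (by omega) _ (fun a => Function.update a 0 0)
    (by simp) ?_ ?_
  · intro a ha i hi
    have hl := hL a (mem_filter.1 ha).1
    have h1 := hl.nonneg i hi
    have h2 := hl.lt_two_mul i hi
    have h3 := hl.nonneg 0 (by omega)
    have h4 := hl.lt_two_mul 0 (by omega)
    rcases eq_or_ne i 0 with rfl | hne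
    · simp; omega
    · simp [hne]; omega
  · have key : ∀ a ∈ L, ∀ b ∈ L, (∀ i, i < r → i ≠ 0 → a i = b i) → OuterGapLe r n 0 b →
        ¬ MovesUp r L 0 a → MovesUp r L 1 b → b 0 ≤ a 0 := by
      intro a ha b hb hab hQ hna hmb
      by_contra! hlt
      have hbu : Function.update a 0 (b 0) = b := by
        funext i
        rcases eq_or_ne i 0 with rfl | hne
        · simp
        · rw [Function.update_of_ne hne]
          rcases lt_or_ge i r with hi | hi
          · exact hab i hi hne
          · rw [(hL a ha).eq_zero i hi, (hL b hb).eq_zero i hi]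
      refine hna (MovesUp.step ha hlt ?_ (by rwa [hbu]))
      have h1 := hQ 0 le_rfl (by omega)
      have h2 := (hL a ha).last_lt
      have h3 := hab (r - 1) (by omega) (by omega)
      have h4 := hab 1 (by omega) (by omega)
      simp only [zero_add] at h1 ⊢
      linarith
    intro a ha b hb hab
    rw [mem_filter] at ha hb
    have hab' : ∀ i, i < r → i ≠ 0 → a i = b i := by
      intro i hi hne
      simpa [hne] using hab i hi
    refine (hL a ha.1).eq_of_forall_lt (hL b hb.1) fun i hi => ?_
    rcases eq_or_ne i 0 with rfl | hne
    · exact le_antisymm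
        (key b hb.1 a ha.1 (fun i hi hne => (hab' i hi hne).symm) ha.2.1 hb.2.2.1 ha.2.2.2)
        (key a ha.1 b hb.1 hab' hb.2.1 ha.2.2.1 hb.2.2.2)
    · exact hab' i hi hne

lemma card_stuck_pos_le {r n : ℕ} {j : ℕ} (hj0 : j ≠ 0) (hj : j + 1 < r) (L : Finset (ℕ → ℤ))
    (hL : ∀ a ∈ L, IsLift r n a) :
    #{a ∈ L | OuterGapLe r n j a ∧ ¬ MovesUp r L j a ∧ MovesUp r L (j + 1) a} ≤
      (8 * n) ^ (r - 1) := by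
  set l : (ℕ → ℤ) → ℕ := fun a => Nat.log 2 (a (j + 1) - a j).toNat with hl
  have hlow : ∀ a ∈ L, (2 : ℤ) ^ l a ≤ a (j + 1) - a j := by
    intro a ha
    have h1 := (hL a ha).lt_succ j hj
    have := Nat.pow_log_le_self 2 (x := (a (j + 1) - a j).toNat) (by omega)
    zify at this
    rwa [Int.toNat_of_nonneg (by omega)] at this
  have hhigh : ∀ a ∈ L, a (j + 1) - a j < (2 : ℤ) ^ (l a + 1) := by
    intro a ha
    have h1 := (hL a ha).lt_succ j hj
    have := Nat.lt_pow_succ_log_self (b := 2) one_lt_two (a (j + 1) - a j).toNat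
    zify at this
    rwa [Int.toNat_of_nonneg (by omega)] at this
  refine card_le_pow_of_injOn_code (j := j) (by omega) _
    (fun a => Function.update (Function.update a 0 (2 ^ (l a + 1) + (a 0 + n - a (r - 1)))) j 0)
    (by simp) ?_ ?_
  · intro a ha i hi
    rw [mem_filter] at ha
    have hla := hL a ha.1
    have h1 := hla.nonneg i hi
    have h2 := hla.lt_two_mul i hi
    have h3 := hlow a ha.1
    have h4 := hhigh a ha.1
    have h5 := ha.2.1 j le_rfl hj
    have h6 := hla.nonneg j (by omega)
    have h7 := hla.lt_two_mul (j + 1) hj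
    have h8 := hla.last_lt
    rcases eq_or_ne i j with rfl | hne
    · simp; omega
    · rw [Function.update_of_ne hne]
      rcases eq_or_ne i 0 with rfl | hne0
      · simp only [Function.update_self]
        push_cast
        rw [pow_succ] at *
        constructor <;> linarith
      · rw [Function.update_of_ne hne0]
        push_cast
        constructor <;> linarith
  · have key : ∀ a ∈ L, ∀ b ∈ L, (∀ i, i < r → i ≠ j → a i = b i) → l a = l b →
        ¬ MovesUp r L j a → MovesUp r L (j + 1) b → b j ≤ a j := by
      intro a ha b hb hab hlab hna hmb
      by_contra! hlt
      have hbu : Function.update a j (b j) = b := by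
        funext i
        rcases eq_or_ne i j with rfl | hne
        · simp
        · rw [Function.update_of_ne hne]
          rcases lt_or_ge i r with hi | hi
          · exact hab i hi hne
          · rw [(hL a ha).eq_zero i hi, (hL b hb).eq_zero i hi]
      refine hna (MovesUp.step ha hlt ?_ (by rwa [hbu]))
      have h1 := hhigh a ha
      have h2 := hlow b hb
      have h4 := hab (j + 1) (by omega) (by omega)
      rw [hlab, pow_succ] at h1
      linarith
    intro a ha b hb hab
    rw [mem_filter] at ha hb
    have hla := hL a ha.1
    have hlb := hL b hb.1
    have hne0 : ∀ i, i < r → i ≠ j → i ≠ 0 → a i = b i := by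
      intro i hi hne hne0
      simpa [hne, hne0] using hab i hi
    have hcode := hab 0 (by omega)
    simp only [Function.update_of_ne hj0.symm, Function.update_self] at hcode
    have h1 := ha.2.1 j le_rfl hj
    have h2 := hb.2.1 j le_rfl hj
    have h3 := hhigh a ha.1
    have h4 := hhigh b hb.1
    have h5 := hla.last_lt
    have h6 := hlb.last_lt
    have hlab : l a = l b := le_antisymm
      (level_le_of_code_eq (by linarith) (by linarith) hcode.symm)
      (level_le_of_code_eq (by linarith) (by linarith) hcode)
    have hab' : ∀ i, i < r → i ≠ j → a i = b i := by
      intro i hi hne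
      rcases eq_or_ne i 0 with rfl | h
      · rw [hlab, hne0 (r - 1) (by omega) (by omega) (by omega)] at hcode
        linarith
      · exact hne0 i hi hne h
    refine hla.eq_of_forall_lt hlb fun i hi => ?_
    rcases eq_or_ne i j with rfl | hne
    · exact le_antisymm
        (key b hb.1 a ha.1 (fun i hi hne => (hab' i hi hne).symm) hlab.symm hb.2.2.1 ha.2.2.2)
        (key a ha.1 b hb.1 hab' hlab ha.2.2.1 hb.2.2.2)
    · exact hab' i hi hne

lemma card_not_movesUp_le {r n : ℕ} (hr : 2 ≤ r) (L : Finset (ℕ → ℤ))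
    (hL : ∀ a ∈ L, IsLift r n a) :
    #{a ∈ L | OuterGapLe r n 0 a ∧ ¬ MovesUp r L 0 a} ≤ (r - 1) * (8 * n) ^ (r - 1) := by
  have main : ∀ d j, j + d = r - 1 →
      #{a ∈ L | OuterGapLe r n j a ∧ ¬ MovesUp r L j a} ≤ d * (8 * n) ^ (r - 1) := by
    intro d
    induction d with
    | zero =>
      intro j hj
      obtain rfl : j = r - 1 := by omega
      rw [zero_mul, Nat.le_zero, Finset.card_eq_zero, Finset.filter_eq_empty_iff]
      intro a ha h
      exact h.2 (movesUp_last ha)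
    | succ d ih =>
      intro j hj
      have hstuck : #{a ∈ L | OuterGapLe r n j a ∧ ¬ MovesUp r L j a ∧ MovesUp r L (j + 1) a} ≤
          (8 * n) ^ (r - 1) := by
        rcases eq_or_ne j 0 with rfl | hj0
        · exact card_stuck_zero_le hr L hL
        · exact card_stuck_pos_le hj0 (by omega) L hL
      calc _ ≤ #({a ∈ L | OuterGapLe r n (j + 1) a ∧ ¬ MovesUp r L (j + 1) a} ∪
              {a ∈ L | OuterGapLe r n j a ∧ ¬ MovesUp r L j a ∧ MovesUp r L (j + 1) a}) := by
            apply Finset.card_le_card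
            intro a ha
            simp only [mem_union, mem_filter] at ha ⊢
            by_cases h : MovesUp r L (j + 1) a
            · exact Or.inr ⟨ha.1, ha.2.1, ha.2.2, h⟩
            · exact Or.inl ⟨ha.1, fun i hi => ha.2.1 i (by omega), h⟩
        _ ≤ _ := Finset.card_union_le _ _
        _ ≤ d * (8 * n) ^ (r - 1) + (8 * n) ^ (r - 1) :=
            Nat.add_le_add (ih (j + 1) (by omega)) hstuck
        _ = _ := by ring
  exact main (r - 1) 0 (by omega)

/-- Reversal of the order of a lift. -/
def reflect (r n : ℕ) (a : ℕ → ℤ) : ℕ → ℤ :=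
  fun i => if i < r then 2 * (n : ℤ) - 1 - a (r - 1 - i) else 0

lemma reflect_reflect {r n : ℕ} {a : ℕ → ℤ} (ha : IsLift r n a) :
    reflect r n (reflect r n a) = a := by
  funext i
  unfold reflect
  split_ifs with h1 h2
  · rw [show r - 1 - (r - 1 - i) = i by omega]
    ring
  · omega
  · exact (ha.eq_zero i (by omega)).symm

lemma IsLift.reflect {r n : ℕ} (hr : 2 ≤ r) {a : ℕ → ℤ} (ha : IsLift r n a) :
    IsLift r n (reflect r n a) := by
  constructor
  · intro i hi
    simp [CrossingPath.reflect, Nat.not_lt.2 hi]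
  · intro i hi
    have := ha.lt_two_mul (r - 1 - i) (by omega)
    simp only [CrossingPath.reflect, if_pos hi]
    omega
  · intro i hi
    have := ha.nonneg (r - 1 - i) (by omega)
    simp only [CrossingPath.reflect, if_pos hi]
    omega
  · intro i hi
    have := ha.lt_succ (r - 1 - (i + 1)) (by omega)
    rw [show r - 1 - (i + 1) + 1 = r - 1 - i by omega] at this
    simp only [CrossingPath.reflect, if_pos hi, if_pos (Nat.lt_of_succ_lt hi)]
    omega
  · have := ha.last_lt
    simp only [CrossingPath.reflect, if_pos (show r - 1 < r by omega),
      if_pos (show 0 < r by omega)]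
    simp only [Nat.sub_self, Nat.sub_zero]
    omega

lemma OuterGapLe.reflect {r n : ℕ} (hr : 2 ≤ r) {a : ℕ → ℤ} (ha : OuterGapLe r n 0 a) :
    OuterGapLe r n 0 (reflect r n a) := by
  intro i _ hi
  have := ha (r - 1 - (i + 1)) (Nat.zero_le _) (by omega)
  rw [show r - 1 - (i + 1) + 1 = r - 1 - i by omega] at this
  simp only [CrossingPath.reflect, if_pos (show r - 1 < r by omega),
    if_pos (show 0 < r by omega), if_pos hi, if_pos (Nat.lt_of_succ_lt hi)]
  simp only [Nat.sub_self, Nat.sub_zero]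
  omega

/-- The entries `a (r-1), …, a 1` can be moved down one after the other, each by less than half of
the gap below it, while staying in `L`. -/
def MovesDown (r : ℕ) (L : Set (ℕ → ℤ)) (a : ℕ → ℤ) : Prop :=
  ∃ b : ℕ → ℤ,
    (∀ i, i + 1 < r → b (i + 1) < a (i + 1) ∧ 2 * (a (i + 1) - b (i + 1)) < a (i + 1) - a i) ∧
    ∀ s, 1 ≤ s → s ≤ r → (fun i => if s ≤ i ∧ i < r then b i else a i) ∈ L

lemma MovesUp.movesDown_of_reflect {r n : ℕ} {L : Finset (ℕ → ℤ)}
    (hL : ∀ a ∈ L, IsLift r n a) {a : ℕ → ℤ} (ha : a ∈ L)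
    (h : MovesUp r (L.image (reflect r n) : Finset (ℕ → ℤ)) 0 (reflect r n a)) :
    MovesDown r L a := by
  obtain ⟨x, hx, hs⟩ := h
  refine ⟨fun i => 2 * (n : ℤ) - 1 - x (r - 1 - i), fun i hi => ?_, fun s h1 h2 => ?_⟩
  · obtain ⟨h1, h2⟩ := hx (r - 1 - (i + 1)) (Nat.zero_le _) (by omega)
    rw [show r - 1 - (i + 1) + 1 = r - 1 - i by omega] at h2
    simp only [reflect, if_pos (show r - 1 - (i + 1) < r by omega),
      if_pos (show r - 1 - i < r by omega), show r - 1 - (r - 1 - (i + 1)) = i + 1 by omega,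
      show r - 1 - (r - 1 - i) = i by omega] at h1 h2
    constructor <;> linarith
  · have := hs (r - s) (Nat.zero_le _) (by omega)
    rw [mem_coe, mem_image] at this
    obtain ⟨c, hc, hce⟩ := this
    have hcc := reflect_reflect (hL c hc)
    rw [hce] at hcc
    rw [mem_coe]
    convert hc using 1
    rw [← hcc]
    funext i
    rcases lt_or_ge i r with hi | hi
    · by_cases hsi : s ≤ i
      · simp only [reflect, if_pos hi]
        rw [if_pos ⟨hsi, hi⟩, if_pos (by omega)]
      · simp only [reflect, if_pos hi]
        rw [if_neg (by omega), if_neg (by omega), if_pos (by omega),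
          show r - 1 - (r - 1 - i) = i by omega]
        ring
    · simp only [reflect, if_neg (Nat.not_lt.2 hi)]
      rw [if_neg (by omega), (hL a ha).eq_zero i hi]

lemma card_not_movesDown_le {r n : ℕ} (hr : 2 ≤ r) (L : Finset (ℕ → ℤ))
    (hL : ∀ a ∈ L, IsLift r n a) :
    #{a ∈ L | OuterGapLe r n 0 a ∧ ¬ MovesDown r L a} ≤ (r - 1) * (8 * n) ^ (r - 1) := by
  refine le_trans ?_ (card_not_movesUp_le hr (L.image (reflect r n)) ?_)
  · apply Finset.card_le_card_of_injOn (reflect r n)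
    · intro a ha
      rw [mem_coe, mem_filter] at ha ⊢
      exact ⟨mem_image_of_mem _ ha.1, ha.2.1.reflect hr,
        fun h => ha.2.2 (h.movesDown_of_reflect hL ha.1)⟩
    · intro a ha b hb hab
      rw [mem_coe, mem_filter] at ha hb
      rw [← reflect_reflect (hL a ha.1), hab, reflect_reflect (hL b hb.1)]
  · intro a ha
    obtain ⟨c, hc, rfl⟩ := mem_image.1 ha
    exact (hL c hc).reflect hr

lemma exists_movesUp_and_movesDown {r n : ℕ} (hr : 2 ≤ r) (L : Finset (ℕ → ℤ))
    (hL : ∀ a ∈ L, IsLift r n a)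
    (hcard : 2 * ((r - 1) * (8 * n) ^ (r - 1)) < #{a ∈ L | OuterGapLe r n 0 a}) :
    ∃ a ∈ L, MovesUp r L 0 a ∧ MovesDown r L a := by
  by_contra! h
  refine hcard.not_ge ?_
  calc _ ≤ #({a ∈ L | OuterGapLe r n 0 a ∧ ¬ MovesUp r L 0 a} ∪
          {a ∈ L | OuterGapLe r n 0 a ∧ ¬ MovesDown r L a}) := by
        apply Finset.card_le_card
        intro a ha
        simp only [mem_union, mem_filter] at ha ⊢
        by_cases hu : MovesUp r L 0 a
        · exact Or.inr ⟨ha.1, ha.2, h a ha.1 hu⟩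
        · exact Or.inl ⟨ha.1, ha.2, hu⟩
    _ ≤ _ := Finset.card_union_le _ _
    _ ≤ _ := Nat.add_le_add (card_not_movesUp_le hr L hL) (card_not_movesDown_le hr L hL)
    _ = _ := by ring

/-- Reduction of an integer modulo `n`. -/
def proj (n : ℕ) [NeZero n] (z : ℤ) : Fin n :=
  ⟨(z % n).toNat, by
    have h : (0 : ℤ) < n := by exact_mod_cast NeZero.pos n
    have := Int.emod_lt_of_pos z h
    have := Int.emod_nonneg z h.ne'
    omega⟩

lemma val_proj {n : ℕ} [NeZero n] (z : ℤ) : ((proj n z : ℕ) : ℤ) = z % n :=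
  Int.toNat_of_nonneg (Int.emod_nonneg z (by exact_mod_cast NeZero.ne n))

lemma proj_add_natCast {n : ℕ} [NeZero n] (z : ℤ) : proj n (z + n) = proj n z := by
  simp [proj]

lemma proj_sub {n : ℕ} [NeZero n] (y z : ℤ) : proj n y - proj n z = proj n (y - z) := by
  apply Fin.ext
  zify
  rw [Fin.sub_def, val_proj]
  have := (proj n z).isLt
  push_cast [this.le, Nat.cast_sub]
  rw [val_proj, val_proj]
  have h1 := Int.mod_modEq y n
  have h2 := Int.mod_modEq z n
  have h3 : (n : ℤ) ≡ 0 [ZMOD n] := by simp [Int.ModEq]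
  have := (h3.sub h2).add h1
  rw [show (0 - z + y : ℤ) = y - z by ring] at this
  exact this

lemma val_proj_of_lt {n : ℕ} [NeZero n] {z : ℤ} (h0 : 0 ≤ z) (h : z < n) :
    ((proj n z : ℕ) : ℤ) = z := by
  rw [val_proj, Int.emod_eq_of_lt h0 h]

lemma cycChain_proj {n l : ℕ} [NeZero n] {w : ℕ → Fin n} (W : ℕ → ℤ)
    (hw : ∀ i, i < l → w i = proj n (W i))
    (hW : ∀ i j, i < j → j < l → W i < W j) (hwrap : ∀ j, j < l → W j < W 0 + n) :
    CycChain l w := by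
  intro i j hij hj
  rw [hw i (by omega), hw j hj, hw 0 (by omega), proj_sub, proj_sub, Fin.lt_def]
  zify
  have h0 : W 0 ≤ W i := by
    rcases Nat.eq_zero_or_pos i with rfl | hi
    · rfl
    · exact (hW 0 i hi (by omega)).le
  have h1 := hW i j hij hj
  have h2 := hwrap j hj
  rw [val_proj_of_lt (by linarith) (by linarith), val_proj_of_lt (by linarith) (by linarith)]
  linarith

/-- Integer lifts of the vertices of the crossing path obtained from an edge `a` with upward moves
`x` and downward moves `b`. -/
def pathLift (r n : ℕ) (a x b : ℕ → ℤ) (i : ℕ) : ℤ :=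
  if i + 1 < r then b (i + 1) else if i + 1 = r then a 0 + n else
  if i + 1 < 2 * r then a (i + 1 - r) else if i + 1 = 2 * r then x 0 + n else x (i + 1 - 2 * r)

lemma isCycCrossPath_pathLift {r n k : ℕ} [NeZero n] (hr : 2 ≤ r) (hk : k ≤ 2 * r - 1)
    {H : Finset (Finset (Fin n))} {a x b : ℕ → ℤ} (ha : IsLift r n a)
    (hx : ∀ i, i + 1 < r → a i < x i ∧ 2 * (x i - a i) < a (i + 1) - a i)
    (hb : ∀ i, i + 1 < r →
      b (i + 1) < a (i + 1) ∧ 2 * (a (i + 1) - b (i + 1)) < a (i + 1) - a i)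
    (hxH : ∀ s, s < r → (range r).image (fun i => proj n (if i < s then x i else a i)) ∈ H)
    (hbH : ∀ s, 1 ≤ s → s ≤ r →
      (range r).image (fun i => proj n (if s ≤ i then b i else a i)) ∈ H) :
    IsCycCrossPath r k H (fun i => proj n (pathLift r n a x b i)) := by
  set V := pathLift r n a x b with hV
  have V1 : ∀ i, i + 1 < r → V i = b (i + 1) := fun i hi => by simp [hV, pathLift, hi]
  have V2 : V (r - 1) = a 0 + n := by
    simp [hV, pathLift, show r - 1 + 1 = r by omega]
  have V3 : ∀ i, i + 1 < r → V (i + r) = a (i + 1) := fun i hi => by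
    simp only [hV, pathLift]
    rw [if_neg (by omega), if_neg (by omega), if_pos (by omega)]
    congr 1
    omega
  have V4 : V (r - 1 + r) = x 0 + n := by
    simp only [hV, pathLift]
    rw [if_neg (by omega), if_neg (by omega), if_neg (by omega), if_pos (by omega)]
  have V5 : ∀ i, i + 2 < r → V (i + 2 * r) = x (i + 1) := fun i hi => by
    simp only [hV, pathLift]
    rw [if_neg (by omega), if_neg (by omega), if_neg (by omega), if_neg (by omega)]
    congr 1
    omega
  have hwrap := ha.last_lt
  have hA : ∀ s, s < r → V s < V (s + r) := by
    intro s hs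
    rcases Nat.lt_or_ge (s + 1) r with h | h
    · rw [V1 s h, V3 s h]
      exact (hb s h).1
    · obtain rfl : s = r - 1 := by omega
      rw [V2, V4]
      linarith [(hx 0 (by omega)).1]
  have hB : ∀ s, s + 2 < r → V (s + r) < V (s + 2 * r) := by
    intro s hs
    rw [V3 s (by omega), V5 s hs]
    exact (hx (s + 1) hs).1
  have hC : ∀ s, s + 1 < r → V (s + r) < V (s + 1) := by
    intro s hs
    rw [V3 s hs]
    rcases Nat.lt_or_ge (s + 1 + 1) r with h | h
    · rw [V1 _ h]
      have := hb (s + 1) h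
      linarith
    · rw [show s + 1 = r - 1 by omega, V2]
      exact hwrap
  have hD : ∀ s, s + 2 < r → V (s + 2 * r) < V (s + 1) := by
    intro s hs
    rw [V5 s hs, V1 _ hs]
    have h1 := hx (s + 1) hs
    have h2 := hb (s + 1) hs
    linarith
  have hmono : ∀ s t, s ≤ t → t < r → V s ≤ V t := by
    intro s t hst
    induction t, hst using Nat.le_induction with
    | base => intro _; rfl
    | succ t _ ih =>
      intro ht
      linarith [ih (by omega), hA t (by omega), hC t ht]
  have hmonoS : ∀ s t, s < t → t < r → V s < V t := by
    intro s t hst ht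
    linarith [hA s (by omega), hC s (by omega), hmono (s + 1) t hst ht]
  have hlo : ∀ s t, s < r → s + t * r < 3 * r - 2 → V s ≤ V (s + t * r) := by
    intro s t hs hst
    have ht : t < 3 := by
      by_contra! hge
      have := Nat.mul_le_mul_right r hge
      omega
    interval_cases t
    · simp
    · simpa using (hA s hs).le
    · linarith [hA s hs, hB s (by omega)]
  have hhi : ∀ s t, s + 1 < r → s + t * r < 3 * r - 2 → V (s + t * r) < V (s + 1) := by
    intro s t hs hst
    have ht : t < 3 := by
      by_contra! hge
      have := Nat.mul_le_mul_right r hge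
      omega
    interval_cases t
    · simpa using hmonoS s (s + 1) (by omega) hs
    · simpa using hC s hs
    · exact hD s (by omega)
  have hcol : ∀ s t t', s < r → t < t' → s + t' * r < 3 * r - 2 →
      V (s + t * r) < V (s + t' * r) := by
    intro s t t' hs htt ht'
    have ht : t' < 3 := by
      by_contra! hge
      have := Nat.mul_le_mul_right r hge
      omega
    interval_cases t'
    · omega
    · obtain rfl : t = 0 := by omega
      simpa using hA s hs
    · interval_cases t
      · simp only [zero_mul, add_zero]
        linarith [hA s hs, hB s (by omega)]
      · simpa using hB s (by omega)
  have hE : ∀ s t, s < r → s + t * r < 3 * r - 2 → V (s + t * r) < V 0 + n := by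
    intro s t hs hst
    have h0 : V (r - 1 + r) < V 0 + n := by
      rw [V4, V1 0 (by omega)]
      have h1 := hx 0 (by omega)
      have h2 := hb 0 (by omega)
      simp only [zero_add] at *
      linarith
    rcases Nat.lt_or_ge (s + 1) r with h | h
    · linarith [hhi s t h hst, hmono (s + 1) (r - 1) (by omega) (by omega), hA (r - 1) (by omega)]
    · obtain rfl : s = r - 1 := by omega
      have ht : t < 2 := by
        by_contra! hge
        have := Nat.mul_le_mul_right r hge
        omega
      interval_cases t
      · simp
        linarith [hA (r - 1) (by omega)]
      · simpa using h0
  have hne : ∀ s t s' t', s < s' → s' < r → s + t * r < 3 * r - 2 → s' + t' * r < 3 * r - 2 →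
      V (s + t * r) < V (s' + t' * r) := by
    intro s t s' t' hs hs' h h'
    linarith [hhi s t (by omega) h, hmono (s + 1) s' hs hs', hlo s' t' hs' h']
  refine ⟨?_, ?_, ?_, ?_, ?_⟩
  · intro i j hi hj hij
    have hdec : ∀ i, i < k + r - 1 → ∃ s t, s < r ∧ i = s + t * r ∧ s + t * r < 3 * r - 2 :=
      fun i hi => ⟨i % r, i / r, Nat.mod_lt _ (by omega), (Nat.mod_add_div' i r).symm, by
        rw [Nat.mod_add_div']; omega⟩
    obtain ⟨s, t, hs, rfl, hst⟩ := hdec i hi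
    obtain ⟨s', t', hs', rfl, hst'⟩ := hdec j hj
    have hVV : V (s + t * r) = V (s' + t' * r) := by
      have h := congrArg (fun z => z - proj n (V 0)) hij
      simp only [proj_sub] at h
      have h1 := hlo s t hs hst
      have h2 := hlo s' t' hs' hst'
      have h3 := hmono 0 s (Nat.zero_le _) hs
      have h4 := hmono 0 s' (Nat.zero_le _) hs'
      have h5 := hE s t hs hst
      have h6 := hE s' t' hs' hst'
      have h7 := congrArg (fun z : Fin n => ((z : ℕ) : ℤ)) h
      rw [val_proj_of_lt (by linarith) (by linarith), val_proj_of_lt (by linarith) (by linarith)]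
        at h7
      linarith
    rcases lt_trichotomy s s' with h | rfl | h
    · exact absurd hVV (hne s t s' t' h hs' hst hst').ne
    · rcases lt_trichotomy t t' with h | rfl | h
      · exact absurd hVV (hcol s t t' hs h hst').ne
      · rfl
      · exact absurd hVV (hcol s t' t hs h hst).ne'
    · exact absurd hVV (hne s' t' s t h hs hst' hst).ne'
  · intro i hi
    rcases Nat.lt_or_ge i r with hir | hir
    · convert hbH (i + 1) (by omega) (by omega) using 1
      ext z
      simp only [mem_image, mem_Ico, mem_range]
      constructor
      · rintro ⟨l, hl, rfl⟩
        rcases lt_trichotomy (l + 1) r with h | h | h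
        · exact ⟨l + 1, h, by rw [if_pos (by omega), V1 l h]⟩
        · obtain rfl : l = r - 1 := by omega
          exact ⟨0, by omega, by rw [if_neg (by omega), V2, proj_add_natCast]⟩
        · obtain ⟨m, rfl⟩ : ∃ m, l = m + r := ⟨l - r, by omega⟩
          exact ⟨m + 1, by omega, by rw [if_neg (by omega), V3 m (by omega)]⟩
      · rintro ⟨l, hl, rfl⟩
        rcases Nat.lt_or_ge i l with h | h
        · refine ⟨l - 1, by omega, ?_⟩
          rw [if_pos (by omega), V1 _ (by omega), Nat.sub_add_cancel (by omega)]
        · rcases Nat.eq_zero_or_pos l with rfl | h0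
          · exact ⟨r - 1, by omega, by rw [if_neg (by omega), V2, proj_add_natCast]⟩
          · refine ⟨l - 1 + r, by omega, ?_⟩
            rw [if_neg (by omega), V3 _ (by omega), Nat.sub_add_cancel (by omega)]
    · convert hxH (i + 1 - r) (by omega) using 1
      ext z
      simp only [mem_image, mem_Ico, mem_range]
      constructor
      · rintro ⟨l, hl, rfl⟩
        rcases lt_trichotomy (l + 1) (2 * r) with h | h | h
        · obtain ⟨m, rfl⟩ : ∃ m, l = m + r := ⟨l - r, by omega⟩
          exact ⟨m + 1, by omega, by rw [if_neg (by omega), V3 m (by omega)]⟩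
        · obtain rfl : l = r - 1 + r := by omega
          exact ⟨0, by omega, by rw [if_pos (by omega), V4, proj_add_natCast]⟩
        · obtain ⟨m, rfl⟩ : ∃ m, l = m + 2 * r := ⟨l - 2 * r, by omega⟩
          exact ⟨m + 1, by omega, by rw [if_pos (by omega), V5 m (by omega)]⟩
      · rintro ⟨l, hl, rfl⟩
        rcases Nat.lt_or_ge l (i + 1 - r) with h | h
        · rw [if_pos h]
          rcases Nat.eq_zero_or_pos l with rfl | h0
          · exact ⟨r - 1 + r, by omega, by rw [V4, proj_add_natCast]⟩
          · refine ⟨l - 1 + 2 * r, by omega, ?_⟩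
            rw [V5 _ (by omega), Nat.sub_add_cancel (by omega)]
        · refine ⟨l - 1 + r, by omega, ?_⟩
          rw [if_neg (by omega), V3 _ (by omega), Nat.sub_add_cancel (by omega)]
  · refine cycChain_proj V (fun _ _ => rfl) hmonoS fun j hj => ?_
    simpa using hE j 0 hj (by omega)
  · intro j hj
    set q := (k + r - 2 - j) / r with hq
    have hqr : q * r ≤ k + r - 2 - j := Nat.div_mul_le_self _ _
    have hle : ∀ i, i ≤ q → j + i * r < 3 * r - 2 := by
      intro i hi
      have : i * r ≤ q * r := Nat.mul_le_mul_right r hi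
      omega
    refine cycChain_proj (fun i => if i ≤ q then V (j + i * r) else V (j + 1)) ?_ ?_ ?_
    · intro i hi
      rcases Nat.eq_zero_or_pos i with rfl | h0
      · simp
      · rw [if_neg (by omega)]
        split_ifs <;> rfl
    · intro i i' hii hi'
      rw [if_pos (by omega : i ≤ q)]
      split_ifs with h
      · exact hcol j i i' (by omega) hii (hle i' h)
      · exact hhi j i hj (hle i (by omega))
    · intro i hi
      simp only [Nat.zero_le, if_true, zero_mul, add_zero]
      have h0 := hmono 0 j (Nat.zero_le _) (by omega)
      split_ifs with h
      · linarith [hE j i (by omega) (hle i h)]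
      · have := hE (j + 1) 0 hj (by omega)
        simp only [zero_mul, add_zero] at this
        linarith
  · have hq : (k + r - 2) / r < 3 := (Nat.div_lt_iff_lt_mul (by omega)).2 (by omega)
    have hV12 := hA (r - 1) (by omega)
    have hV0 := hmonoS 0 (r - 1) (by omega) (by omega)
    have hV2 := hE (r - 1) 1 (by omega) (by omega)
    rw [one_mul] at hV2
    have hidx : 2 * r - 1 = r - 1 + r := by omega
    refine cycChain_proj (fun i => if i = 0 then V 0 else V (i * r - 1)) ?_ ?_ ?_
    · intro i _
      split_ifs <;> rfl
    · intro i j hij hj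
      have hj3 : j < 3 := by omega
      interval_cases j
      · omega
      · obtain rfl : i = 0 := by omega
        simpa using hV0
      · interval_cases i
        · simp only [if_true, hidx, OfNat.ofNat_ne_zero, if_false]
          linarith
        · simp only [hidx, OfNat.ofNat_ne_zero, if_false, one_ne_zero, one_mul]
          linarith
    · intro j hj
      have hj3 : j < 3 := by omega
      have : (0 : ℤ) < n := by exact_mod_cast NeZero.pos n
      interval_cases j
      · simp; omega
      · simp only [if_true, one_ne_zero, if_false, one_mul]
        linarith
      · simp only [if_true, hidx, OfNat.ofNat_ne_zero, if_false]
        linarith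

lemma proj_val {n : ℕ} [NeZero n] (w : Fin n) : proj n (w : ℕ) = w := by
  apply Fin.ext
  zify
  rw [val_proj_of_lt (by positivity) (by exact_mod_cast w.isLt)]

lemma exists_isLift_outerGapLe {r n : ℕ} [NeZero n] (hr : 2 ≤ r) {e : Finset (Fin n)}
    (he : e.card = r) :
    ∃ a, IsLift r n a ∧ OuterGapLe r n 0 a ∧ (range r).image (fun i => proj n (a i)) = e := by
  obtain ⟨⟨p, q⟩, hpq, hmin⟩ := Finset.exists_min_image e.offDiag
    (fun z => ((z.1 - z.2 : Fin n) : ℕ)) (by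
      obtain ⟨x, hx, y, hy, hxy⟩ := Finset.one_lt_card.1 (show 1 < e.card by omega)
      exact ⟨(x, y), by simp [hx, hy, hxy]⟩)
  rw [mem_offDiag] at hpq
  obtain ⟨hp, hq, hne⟩ := hpq
  simp only at hp hq hne hmin
  have hcard : (e.image fun z => ((z - p : Fin n) : ℕ)).card = r := by
    rw [Finset.card_image_of_injective, he]
    intro x y hxy
    simpa using Fin.ext hxy
  set D := e.image fun z => ((z - p : Fin n) : ℕ) with hD
  set d := D.orderEmbOfFin hcard with hd
  have hdD : ∀ i, ∃ z ∈ e, ((z - p : Fin n) : ℕ) = d i := fun i =>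
    mem_image.1 (D.orderEmbOfFin_mem hcard i)
  have hDd : ∀ z ∈ e, ∃ i, d i = ((z - p : Fin n) : ℕ) := fun z hz => by
    have h : ((z - p : Fin n) : ℕ) ∈ Set.range d := by
      rw [hd, Finset.range_orderEmbOfFin]
      exact mem_image_of_mem _ hz
    exact h
  have hdn : ∀ i, d i < n := fun i => by
    obtain ⟨z, -, h⟩ := hdD i
    rw [← h]
    exact (z - p).isLt
  have hd0 : d ⟨0, by omega⟩ = 0 := by
    obtain ⟨i, hi⟩ := hDd p hp
    have : d ⟨0, by omega⟩ ≤ d i := d.monotone (Fin.le_def.2 (Nat.zero_le _))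
    simp at hi
    omega
  have hdlast : ((q - p : Fin n) : ℕ) ≤ d ⟨r - 1, by omega⟩ := by
    obtain ⟨i, hi⟩ := hDd q hq
    rw [← hi]
    exact d.monotone (Fin.le_def.2 (Nat.le_sub_one_of_lt i.isLt))
  have hsum : ((p - q : Fin n) : ℕ) + ((q - p : Fin n) : ℕ) = n := by
    have h1 := p.isLt
    have h2 := q.isLt
    rcases lt_or_gt_of_ne hne with h | h
    · have h3 := Fin.coe_sub_iff_lt.2 h
      rw [h3, Fin.sub_val_of_le h.le]
      rw [Fin.lt_def] at h
      omega
    · have h3 := Fin.coe_sub_iff_lt.2 h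
      rw [h3, Fin.sub_val_of_le h.le]
      rw [Fin.lt_def] at h
      omega
  have hgap : ∀ i (hi : i + 1 < r),
      ((p - q : Fin n) : ℕ) + d ⟨i, by omega⟩ ≤ d ⟨i + 1, hi⟩ := by
    intro i hi
    obtain ⟨z, hz, h1⟩ := hdD ⟨i, by omega⟩
    obtain ⟨w, hw, h2⟩ := hdD ⟨i + 1, hi⟩
    have hlt : d ⟨i, by omega⟩ < d ⟨i + 1, hi⟩ := d.strictMono (Fin.lt_def.2 (Nat.lt_succ_self _))
    have hwz : w ≠ z := by
      rintro rfl
      omega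
    have h3 := hmin (w, z) (by simp [hw, hz, hwz])
    have h4 : ((w - p : Fin n) - (z - p) : Fin n) = w - z := sub_sub_sub_cancel_right w z p
    have h5 := Fin.sub_val_of_le (a := w - p) (b := z - p) (Fin.le_def.2 (by omega))
    rw [h4] at h5
    simp only at h3
    omega
  refine ⟨fun i => if h : i < r then ((p : ℕ) : ℤ) + d ⟨i, h⟩ else 0, ⟨?_, ?_, ?_, ?_, ?_⟩, ?_, ?_⟩
  · intro i hi
    simp [Nat.not_lt.2 hi]
  · intro i hi
    simp only [hi, dite_true]
    positivity
  · intro i hi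
    simp only [hi, dite_true]
    have := hdn ⟨i, hi⟩
    have := p.isLt
    omega
  · intro i hi
    simp only [hi, Nat.lt_of_succ_lt hi, dite_true]
    have hlt : d ⟨i, by omega⟩ < d ⟨i + 1, hi⟩ := d.strictMono (Fin.lt_def.2 (Nat.lt_succ_self _))
    omega
  · simp only [show r - 1 < r by omega, show 0 < r by omega, dite_true]
    have := hdn ⟨r - 1, by omega⟩
    omega
  · intro i _ hi
    simp only [show r - 1 < r by omega, show 0 < r by omega, hi, Nat.lt_of_succ_lt hi, dite_true]
    have := hgap i hi
    omega
  · have hproj : ∀ z : Fin n, proj n (((p : ℕ) : ℤ) + ((z - p : Fin n) : ℕ)) = z := by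
      intro z
      have h := proj_sub (n := n) (((p : ℕ) : ℤ) + ((z - p : Fin n) : ℕ)) ((p : ℕ) : ℤ)
      rw [add_sub_cancel_left, proj_val, proj_val] at h
      exact sub_left_inj.1 h
    ext z
    simp only [mem_image, mem_range]
    constructor
    · rintro ⟨i, hi, rfl⟩
      obtain ⟨z, hz, h⟩ := hdD ⟨i, hi⟩
      rw [dif_pos hi, ← h, hproj]
      exact hz
    · intro hz
      obtain ⟨i, hi⟩ := hDd z hz
      refine ⟨i, i.isLt, ?_⟩
      rw [dif_pos i.isLt, Fin.eta, hi, hproj]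

lemma finite_isLift (r n : ℕ) : {a | IsLift r n a}.Finite := by
  refine Set.Finite.of_finite_image (f := fun (a : ℕ → ℤ) (i : Fin r) => a i) ?_ ?_
  · refine (Set.finite_Icc (fun _ : Fin r => (0 : ℤ)) (fun _ => 2 * (n : ℤ))).subset ?_
    rintro _ ⟨a, ha, rfl⟩
    exact ⟨fun i => ha.nonneg i i.2, fun i => (ha.lt_two_mul i i.2).le⟩
  · intro a ha b hb hab
    exact IsLift.eq_of_forall_lt ha hb fun i hi => congrFun hab ⟨i, hi⟩

lemma card_le_of_not_isCycCrossPath {r n k : ℕ} [NeZero n] (hr : 2 ≤ r) (hk : k ≤ 2 * r - 1)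
    {H : Finset (Finset (Fin n))} (hH : ∀ e ∈ H, e.card = r)
    (hfree : ¬ ∃ v : ℕ → Fin n, IsCycCrossPath r k H v) :
    H.card ≤ 2 * ((r - 1) * (8 * n) ^ (r - 1)) := by
  by_contra! hlt
  have hfin : {a | IsLift r n a ∧ (range r).image (fun i => proj n (a i)) ∈ H}.Finite :=
    (finite_isLift r n).subset fun a ha => ha.1
  obtain ⟨a, haL, ⟨x, hx, hxL⟩, ⟨b, hb, hbL⟩⟩ :=
    exists_movesUp_and_movesDown (n := n) hr hfin.toFinset
      (fun a ha => (hfin.mem_toFinset.1 ha).1) (hlt.trans_le (by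
        refine le_trans (Finset.card_le_card ?_) (Finset.card_image_le
          (f := fun a : ℕ → ℤ => (range r).image (fun i => proj n (a i))))
        intro e he
        obtain ⟨a, ha, hQ, hae⟩ := exists_isLift_outerGapLe hr (hH e he)
        refine mem_image.2 ⟨a, ?_, hae⟩
        rw [mem_filter, hfin.mem_toFinset]
        exact ⟨⟨ha, hae ▸ he⟩, hQ⟩))
  rw [hfin.mem_toFinset] at haL
  refine hfree ⟨_, isCycCrossPath_pathLift hr hk haL.1 (fun i hi => hx i (Nat.zero_le i) hi) hb
    (fun s hs => ?_) (fun s hs hsr => ?_)⟩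
  · simpa using (hfin.mem_toFinset.1 (mem_coe.1 (hxL s (Nat.zero_le s) hs))).2
  · have := (hfin.mem_toFinset.1 (mem_coe.1 (hbL s hs hsr))).2
    convert this using 1
    refine Finset.image_congr fun i hi => ?_
    simp [mem_range.1 (mem_coe.1 hi)]

/-- The sum of the vertices of an edge is constant modulo `n` on some large uniform family, and
such a family contains no crossing path with at least two edges. -/
lemma exists_not_isCycCrossPath {r n k : ℕ} [NeZero n] (hr : 1 ≤ r) (hk : 2 ≤ k) :
    ∃ H : Finset (Finset (Fin n)), (∀ e ∈ H, e.card = r) ∧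
      (¬ ∃ v : ℕ → Fin n, IsCycCrossPath r k H v) ∧ n.choose r ≤ n * H.card := by
  set F : Fin n → Finset (Finset (Fin n)) :=
    fun c => {e ∈ powersetCard r univ | ∑ z ∈ e, z = c} with hF
  have hcount : n.choose r = ∑ c, (F c).card := by
    rw [← Finset.card_eq_sum_card_fiberwise (t := univ) (by simp)]
    simp
  obtain ⟨c, hc⟩ : ∃ c, n.choose r ≤ n * (F c).card := by
    by_contra! h
    have h2 : ∑ c, n * (F c).card < ∑ _c : Fin n, n.choose r :=
      Finset.sum_lt_sum_of_nonempty univ_nonempty fun c _ => h c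
    rw [← Finset.mul_sum, ← hcount] at h2
    simp at h2
  refine ⟨F c, fun e he => ?_, ?_, hc⟩
  · rw [hF, mem_filter, mem_powersetCard] at he
    exact he.1.2
  · rintro ⟨v, hinj, hedge, -⟩
    have hsum : ∀ i, i < 2 → ∑ l ∈ Ico i (i + r), v l = c := by
      intro i hi
      have h := (mem_filter.1 (hedge i (by omega))).2
      rwa [Finset.sum_image] at h
      intro l hl m hm hlm
      simp only [coe_Ico, Set.mem_Ico] at hl hm
      exact hinj l m (by omega) (by omega) hlm
    have h0 := hsum 0 (by omega)
    have h1 := hsum 1 (by omega)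
    rw [zero_add, Finset.sum_eq_sum_Ico_succ_bot (by omega)] at h0
    rw [add_comm 1 r, Finset.sum_Ico_succ_top (by omega), add_comm] at h1
    have := add_right_cancel (h0.trans h1.symm)
    have := hinj 0 r (by omega) (by omega) this
    omega

end CrossingPath

/-- For fixed `r ≥ 2` and `3 ≤ k ≤ 2r−1` there are constants
`c₁, c₂ > 0` with `c₁·n^(r−1) ≤ ex_↻(n, P_k^r) ≤ c₂·n^(r−1)` for all `n ≥ 2r+1`. -/
theorem stmt7 (r k : ℕ) (hr : 2 ≤ r) (hk3 : 3 ≤ k) (hk : k ≤ 2 * r - 1) :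
    ∃ c₁ c₂ : ℝ, 0 < c₁ ∧ 0 < c₂ ∧ ∀ n : ℕ, 2 * r + 1 ≤ n →
      c₁ * (n : ℝ) ^ (r - 1) ≤ (exCycP n r k : ℝ) ∧
      (exCycP n r k : ℝ) ≤ c₂ * (n : ℝ) ^ (r - 1) := by
  have hr1 : (0 : ℝ) < ((r - 1 : ℕ) : ℝ) := by exact_mod_cast (show 0 < r - 1 by omega)
  refine ⟨1 / (2 ^ r * r.factorial), 2 * ((r - 1 : ℕ) * 8 ^ (r - 1)), by positivity,
    by positivity, fun n hn => ?_⟩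
  have : NeZero n := ⟨by omega⟩
  have hn0 : (0 : ℝ) < n := by exact_mod_cast NeZero.pos n
  have hub : 2 * ((r - 1) * (8 * n) ^ (r - 1)) ∈ upperBounds {m | ∃ H : Finset (Finset (Fin n)),
      (∀ e ∈ H, e.card = r) ∧ (¬ ∃ v : ℕ → Fin n, IsCycCrossPath r k H v) ∧ H.card = m} := by
    rintro _ ⟨H, hH, hfree, rfl⟩
    exact CrossingPath.card_le_of_not_isCycCrossPath hr hk hH hfree
  constructor
  · obtain ⟨H, hH, hfree, hcard⟩ :=
      CrossingPath.exists_not_isCycCrossPath (n := n) (k := k) (show 1 ≤ r by omega) (by omega)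
    have h1 : H.card ≤ exCycP n r k := le_csSup ⟨_, hub⟩ ⟨H, hH, hfree, rfl⟩
    have h2 : (n.choose r : ℝ) ≤ n * exCycP n r k := by
      exact_mod_cast hcard.trans (Nat.mul_le_mul_left n h1)
    have h3 := Nat.pow_le_choose (α := ℝ) r n
    have h4 : (n : ℝ) / 2 ≤ ((n + 1 - r : ℕ) : ℝ) := by
      rw [div_le_iff₀ two_pos]
      exact_mod_cast (show n ≤ (n + 1 - r) * 2 by omega)
    have h5 : ((n : ℝ) / 2) ^ r / r.factorial ≤ n * exCycP n r k :=
      le_trans (by gcongr) (h3.trans h2)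
    refine le_of_mul_le_mul_left (le_trans (le_of_eq ?_) h5) hn0
    rw [div_pow]
    obtain ⟨m, rfl⟩ : ∃ m, r = m + 1 := ⟨r - 1, by omega⟩
    rw [Nat.add_sub_cancel, pow_succ (n : ℝ)]
    field_simp
  · have h : exCycP n r k ≤ 2 * ((r - 1) * (8 * n) ^ (r - 1)) := csSup_le' hub
    calc (exCycP n r k : ℝ) ≤ (2 * ((r - 1) * (8 * n) ^ (r - 1)) : ℕ) := by exact_mod_cast h
      _ = _ := by
        push_cast
        ring
end

section
/- Let r ≥ 2 and n > 20r. Let G(n, r, r+2) be the family of all r-element subsets {a_1 < a_2 < ... < a_r} of {1, ..., n} (inequalities as integers) such that a_2 − a_1 = 2^p for some nonnegative integer p with 2^p ≤ n/4. Then G(n, r, r+2), viewed as a cg r-graph on Ω_n (the set {1, ..., n} with its clockwise cyclic order), contains no crossing 2r-path P_{2r}^r. Consequently, for every fixed k ≥ 2r ≥ 4 there is a constant c > 0 such that ex_↻(n, P_k^r) ≥ c · n^{r−1} · log n for all sufficiently large n. -/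
/-- The family `G(n, r, r+2)`: the two smallest elements of each `r`-set differ by a power of two
that is at most `n / 4`. -/
def IsDyadicGapSet (n r : ℕ) (e : Finset (Fin n)) : Prop :=
  e.card = r ∧ ∃ a ∈ e, ∃ b ∈ e,
    (∀ c ∈ e, a ≤ c) ∧ (∀ c ∈ e, c ≠ a → b ≤ c) ∧
    ∃ p : ℕ, (b : ℕ) - (a : ℕ) = 2 ^ p ∧ 2 ^ p ≤ n / 4

theorem two_mul_two_pow_le_of_lt {i j : ℕ} (h : 2 ^ i < 2 ^ j) : 2 * 2 ^ i ≤ 2 ^ j := by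
  have hij : i < j := (Nat.pow_lt_pow_iff_right (by norm_num)).1 h
  calc 2 * 2 ^ i = 2 ^ (i + 1) := by ring
    _ ≤ 2 ^ j := Nat.pow_le_pow_right (by norm_num) hij

/-- No crossing zigzag on `a < b < c < d` with the three gaps `ca`, `da`, `db` powers of two. -/
theorem not_dyadic_zigzag {a b c d i j k : ℕ} (hab : a < b) (hbc : b < c) (hcd : c < d)
    (hi : c = a + 2 ^ i) (hj : d = a + 2 ^ j) (hk : d = b + 2 ^ k) : False := by
  have h1 := two_mul_two_pow_le_of_lt (i := i) (j := j) (by omega)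
  have h2 := two_mul_two_pow_le_of_lt (i := k) (j := j) (by omega)
  omega

/-- On `x < y₀ < y₁ < y₂ < z` the gaps `zy₀`, `zy₁`, `y₁x`, `y₂x` are not all powers of two. -/
theorem not_dyadic_double_fan {x y₀ y₁ y₂ z i j k l : ℕ} (h₀ : x < y₀) (h₀₁ : y₀ < y₁)
    (h₁₂ : y₁ < y₂) (h₂ : y₂ < z) (hi : z = y₀ + 2 ^ i) (hj : z = y₁ + 2 ^ j)
    (hk : y₁ = x + 2 ^ k) (hl : y₂ = x + 2 ^ l) : False := by
  have h1 := two_mul_two_pow_le_of_lt (i := j) (j := i) (by omega)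
  have h2 := two_mul_two_pow_le_of_lt (i := k) (j := l) (by omega)
  rcases lt_or_ge (2 ^ k) (2 ^ i) with h | h
  · have h3 := two_mul_two_pow_le_of_lt h
    omega
  · omega

theorem Fin.val_sub_eq_ite {n : ℕ} (a b : Fin n) :
    (a - b).val = if b.val ≤ a.val then a.val - b.val else n + a.val - b.val := by
  have ha := a.isLt
  have hb := b.isLt
  split_ifs with h
  · exact Fin.sub_val_of_le h
  · exact Fin.coe_sub_iff_lt.2 (Fin.lt_def.2 (not_le.1 h))

/-- The rank of the `c`-th vertex of a crossing path on `3 * r - 1` vertices, in the cyclic order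
starting at the initial vertex (up to skipped values). -/
def crossRank (r c : ℕ) : ℕ :=
  if c < r then 3 * c else if c < 2 * r then 3 * (c - r) + 1 else 3 * (c - 2 * r) + 2

theorem crossRank_cases (r c : ℕ) :
    (c < r ∧ crossRank r c = 3 * c) ∨
    (r ≤ c ∧ c < 2 * r ∧ crossRank r c = 3 * (c - r) + 1) ∨
    (2 * r ≤ c ∧ crossRank r c = 3 * (c - 2 * r) + 2) := by
  unfold crossRank
  split_ifs <;> omega

/-- `c` comes strictly before `d` when ranks are listed cyclically, starting from that of `m`. -/
def CrossBefore (r m c d : ℕ) : Prop :=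
  (crossRank r m ≤ crossRank r c ∧ crossRank r c < crossRank r d) ∨
  (crossRank r c < crossRank r d ∧ crossRank r d < crossRank r m) ∨
  (crossRank r d < crossRank r m ∧ crossRank r m ≤ crossRank r c)

theorem IsCycCrossPath.interleaved {r k n : ℕ} (hr : 2 ≤ r) (hk : 2 * r ≤ k)
    {H : Finset (Finset (Fin n))} {v : ℕ → Fin n} (h : IsCycCrossPath r k H v) {j : ℕ}
    (hj : j + 1 < r) :
    (v j - v 0).val < (v (j + r) - v 0).val ∧
    (v (j + r) - v 0).val < (v (j + 2 * r) - v 0).val ∧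
    (v (j + 2 * r) - v 0).val < (v (j + 1) - v 0).val := by
  obtain ⟨-, -, h1, h2, -⟩ := h
  have hL : 2 ≤ (k + r - 2 - j) / r := by
    rw [Nat.le_div_iff_mul_le (by omega)]; omega
  specialize h2 j hj
  set L := (k + r - 2 - j) / r with hLdef
  have e01 := h2 0 1 (by omega) (by omega)
  have e12 := h2 1 2 (by omega) (by omega)
  have e2L := h2 2 (L + 1) (by omega) (by omega)
  have hL1 : ¬ (L + 1 ≤ L) := by omega
  have hL' : 1 ≤ L := by omega
  simp only [if_true, one_ne_zero, if_false, hL, hL', hL1, OfNat.ofNat_ne_zero, one_mul,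
    Nat.succ_ne_zero] at e01 e12 e2L
  have e1 : (v j - v 0).val < (v (j + 1) - v 0).val ∨ j = 0 := by
    rcases Nat.eq_zero_or_pos j with h0 | h0
    · exact Or.inr h0
    · exact Or.inl (h1 j (j + 1) (by omega) hj)
  have hsub : ∀ a, (v a - v j).val = if (v j - v 0).val ≤ (v a - v 0).val
      then (v a - v 0).val - (v j - v 0).val else n + (v a - v 0).val - (v j - v 0).val := by
    intro a
    have : NeZero n := ⟨by have := (v 0).isLt; omega⟩
    rw [← Fin.val_sub_eq_ite, sub_sub_sub_cancel_right]
  have bj := (v j - v 0).isLt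
  have e0 : j = 0 → (v j - v 0).val = 0 := by
    rintro rfl
    rw [Fin.val_sub_eq_ite, if_pos le_rfl, Nat.sub_self]
  rw [Fin.lt_def] at e01 e12 e2L
  rw [hsub] at e01 e12 e2L
  rw [hsub] at e01 e12 e2L
  have h1j : (v j - v 0).val ≤ (v (j + 1) - v 0).val := by omega
  rw [if_pos le_rfl] at e01
  rw [if_pos h1j] at e2L
  split_ifs at * <;> omega

theorem IsCycCrossPath.pos_lt_of_crossRank_lt {r k n : ℕ} (hr : 2 ≤ r) (hk : 2 * r ≤ k)
    {H : Finset (Finset (Fin n))} {v : ℕ → Fin n} (h : IsCycCrossPath r k H v) {c d : ℕ}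
    (hc : c < 3 * r - 1) (hd : d < 3 * r - 1) (hcd : crossRank r c < crossRank r d) :
    (v c - v 0).val < (v d - v 0).val := by
  have hI := fun j hj => h.interleaved hr hk (j := j) hj
  obtain ⟨-, -, h1, -, h3⟩ := h
  have hlast : (v (r - 1) - v 0).val < (v (2 * r - 1) - v 0).val := by
    have hL : 2 ≤ (k + r - 2) / r := by
      rw [Nat.le_div_iff_mul_le (by omega)]; omega
    have := h3 1 2 (by omega) (by omega)
    simpa using this
  have hmono : ∀ i j, i ≤ j → j < r → (v i - v 0).val ≤ (v j - v 0).val := by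
    intro i j hij hj
    rcases hij.eq_or_lt with rfl | hij
    · exact le_rfl
    · rcases Nat.eq_zero_or_pos i with rfl | hi
      · exact (h1 0 j hij hj).le
      · exact (h1 i j hij hj).le
  generalize hP : (fun i => (v i - v 0).val) = P
  have hPe : ∀ i, (v i - v 0).val = P i := fun i => congrFun hP i
  simp only [hPe] at *
  have hlo : ∀ x, x < 3 * r - 1 → ∃ i < r, (x = i ∨ x = i + r ∨ x = i + 2 * r) ∧
      i = crossRank r x / 3 ∧ P i ≤ P x ∧ (i + 1 < r → P x < P (i + 1)) := by
    intro x hx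
    unfold crossRank
    by_cases hx1 : x < r
    · refine ⟨x, hx1, by simp, by simp [hx1], le_rfl, fun h => ?_⟩
      have := hI x h
      omega
    · by_cases hx2 : x < 2 * r
      · obtain ⟨i, rfl⟩ : ∃ i, x = i + r := ⟨x - r, by omega⟩
        refine ⟨i, by omega, by simp, by simp [hx2]; omega, ?_, fun h => ?_⟩
        · by_cases h : i + 1 < r
          · have := hI i h
            omega
          · obtain rfl : i = r - 1 := by omega
            rw [show r - 1 + r = 2 * r - 1 by omega]
            exact hlast.le
        · have := hI i h
          omega
      · obtain ⟨i, rfl⟩ : ∃ i, x = i + 2 * r := ⟨x - 2 * r, by omega⟩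
        have := hI i (by omega)
        exact ⟨i, by omega, by simp, by rw [if_neg hx1, if_neg hx2]; omega, by omega,
          fun h => by omega⟩
  obtain ⟨i, hi, hci, hi', hic, hci'⟩ := hlo c hc
  obtain ⟨j, hj, hdj, hj', hjd, -⟩ := hlo d hd
  rcases lt_trichotomy i j with hij | hij | hij
  · have := hmono (i + 1) j hij hj
    have := hci' (by omega)
    omega
  · subst hij
    by_cases hir : i + 1 < r
    · have := hI i hir
      unfold crossRank at hcd
      rcases hci with rfl | rfl | rfl <;> rcases hdj with rfl | rfl | rfl <;>
        first
        | omega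
        | (exfalso; split_ifs at hcd <;> omega)
    · obtain rfl : i = r - 1 := by omega
      have e : r - 1 + r = 2 * r - 1 := by omega
      unfold crossRank at hcd
      rcases hci with rfl | rfl | rfl <;> rcases hdj with rfl | rfl | rfl <;>
        first
        | omega
        | (rw [e]; exact hlast)
        | (exfalso; split_ifs at hcd <;> omega)
  · omega

theorem IsCycCrossPath.val_lt_of_crossBefore {r k n : ℕ} (hr : 2 ≤ r) (hk : 2 * r ≤ k)
    {H : Finset (Finset (Fin n))} {v : ℕ → Fin n} (h : IsCycCrossPath r k H v) {m : ℕ}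
    (hm : m < 3 * r - 1) (hmin : ∀ c < 3 * r - 1, (v m).val ≤ (v c).val) {c d : ℕ}
    (hc : c < 3 * r - 1) (hd : d < 3 * r - 1) (hcd : CrossBefore r m c d) :
    (v c).val < (v d).val := by
  have hlt := fun {x y} => h.pos_lt_of_crossRank_lt hr hk (c := x) (d := y)
  have hmc : crossRank r m = crossRank r c → (v m).val = (v c).val := by
    intro e
    have : m = c := by
      unfold crossRank at e
      split_ifs at e <;> omega
    rw [this]
  have b0 := (v 0).isLt
  have bc := (v c).isLt
  have bd := (v d).isLt
  have bm := (v m).isLt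
  have hmc' := hmin c hc
  have hmd' := hmin d hd
  have key : (v m).val = (v c).val ∨ crossRank r m < crossRank r c ∨
      crossRank r c < crossRank r m := by
    rcases lt_trichotomy (crossRank r m) (crossRank r c) with h | h | h
    · exact Or.inr (Or.inl h)
    · exact Or.inl (hmc h)
    · exact Or.inr (Or.inr h)
  simp only [Fin.val_sub_eq_ite] at hlt
  rcases hcd with ⟨h1, h2⟩ | ⟨h1, h2⟩ | ⟨h1, h2⟩
  · have a := hlt hc hd h2
    rcases key with h | h | h
    · split_ifs at * <;> omega
    · have b := hlt hm hc h
      split_ifs at * <;> omega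
    · omega
  · have a := hlt hc hd h1
    have b := hlt hd hm h2
    split_ifs at * <;> omega
  · have a := hlt hd hm h1
    rcases key with h | h | h
    · split_ifs at * <;> omega
    · have b := hlt hm hc h
      split_ifs at * <;> omega
    · omega

theorem exists_two_pow_gap {n r i α β : ℕ} {v : ℕ → Fin n}
    (he : IsDyadicGapSet n r (Finset.image v (Finset.Ico i (i + r))))
    (hα : i ≤ α ∧ α < i + r) (hβ : i ≤ β ∧ β < i + r) (hαβ : (v α).val < (v β).val)
    (hc : ∀ c, i ≤ c → c < i + r → c ≠ α → c ≠ β → (v β).val < (v c).val) :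
    ∃ p : ℕ, (v β).val = (v α).val + 2 ^ p := by
  obtain ⟨-, a, ha, b, hb, hamin, hbmin, p, hp, -⟩ := he
  have hpos : 0 < 2 ^ p := by positivity
  simp only [Finset.mem_image, Finset.mem_Ico] at ha hb
  obtain ⟨c, hcm, rfl⟩ := ha
  obtain ⟨d, hdm, rfl⟩ := hb
  have mem : ∀ x, i ≤ x ∧ x < i + r → v x ∈ Finset.image v (Finset.Ico i (i + r)) := fun x hx =>
    Finset.mem_image_of_mem v (Finset.mem_Ico.2 hx)
  have hcα : c = α := by
    by_contra hne
    have h1 : (v c).val ≤ (v α).val := hamin _ (mem α hα)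
    by_cases hcβ : c = β
    · subst hcβ; omega
    · have := hc c hcm.1 hcm.2 hne hcβ
      omega
  subst hcα
  have hdβ : d = β := by
    by_contra hne
    have h1 : (v d).val ≤ (v β).val := hbmin _ (mem β hβ) (by
      intro h; rw [h] at hαβ; omega)
    by_cases hdc : d = c
    · subst hdc; omega
    · have := hc d hdm.1 hdm.2 hdc hne
      omega
  subst hdβ
  exact ⟨p, by omega⟩

theorem not_isCycCrossPath_of_isDyadicGapSet {r k n : ℕ} (hr : 2 ≤ r) (hk : 2 * r ≤ k)
    {H : Finset (Finset (Fin n))} (hH : ∀ e ∈ H, IsDyadicGapSet n r e) (v : ℕ → Fin n) :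
    ¬ IsCycCrossPath r k H v := by
  intro h
  obtain ⟨m, hm, hmin⟩ := Finset.exists_min_image (Finset.range (3 * r - 1)) (fun i => (v i).val)
    ⟨0, by simp; omega⟩
  simp only [Finset.mem_range] at hm hmin
  have hlt := fun {c d} => h.val_lt_of_crossBefore hr hk hm hmin (c := c) (d := d)
  have hgap : ∀ i α β, i < 2 * r → (i ≤ α ∧ α < i + r) → (i ≤ β ∧ β < i + r) →
      CrossBefore r m α β →
      (∀ c, i ≤ c → c < i + r → c ≠ α → c ≠ β → CrossBefore r m β c) →
      ∃ p : ℕ, (v β).val = (v α).val + 2 ^ p := by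
    intro i α β hi hα hβ hαβ hc
    exact exists_two_pow_gap (hH _ (h.2.1 i (by omega))) hα hβ
      (hlt (by omega) (by omega) hαβ)
      (fun c h1 h2 h3 h4 => hlt (by omega) (by omega) (hc c h1 h2 h3 h4))
  have zigzag : ∀ s, s < r → (m = s + r - 1 ∨ m + 1 = s ∨ (s = 0 ∧ m = 3 * r - 2)) → False := by
    intro s hs hms
    have k₁ : crossRank r s = 3 * s := if_pos hs
    have k₂ : crossRank r (s + r) = 3 * s + 1 := by unfold crossRank; split_ifs <;> omega
    have k₃ : (s = 0 ∧ crossRank r (s + r - 1) + 3 = 3 * r) ∨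
        (0 < s ∧ crossRank r (s + r - 1) + 2 = 3 * s) := by
      unfold crossRank; split_ifs <;> omega
    have k₄ : crossRank r (s + 2 * r - 1) = crossRank r (s + r - 1) + 1 := by
      unfold crossRank; split_ifs <;> omega
    have k₅ : crossRank r m = crossRank r (s + r - 1) ∨
        crossRank r m + 1 = crossRank r (s + r - 1) := by
      unfold crossRank; split_ifs <;> omega
    obtain ⟨i, hi⟩ := hgap s (s + r - 1) s (by omega) (by omega) (by omega)
      (by unfold CrossBefore; omega)
      (fun c _ _ _ _ => by unfold CrossBefore; rcases crossRank_cases r c with h | h | h <;> omega)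
    obtain ⟨j, hj⟩ := hgap (s + 1) (s + r - 1) (s + r) (by omega) (by omega) (by omega)
      (by unfold CrossBefore; omega)
      (fun c _ _ _ _ => by unfold CrossBefore; rcases crossRank_cases r c with h | h | h <;> omega)
    obtain ⟨l, hl⟩ := hgap (s + r) (s + 2 * r - 1) (s + r) (by omega) (by omega) (by omega)
      (by unfold CrossBefore; omega)
      (fun c _ _ _ _ => by unfold CrossBefore; rcases crossRank_cases r c with h | h | h <;> omega)
    exact not_dyadic_zigzag (hlt (c := s + r - 1) (d := s + 2 * r - 1) (by omega) (by omega) (by unfold CrossBefore; omega))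
      (hlt (d := s) (by omega) (by omega) (by unfold CrossBefore; omega)) (hlt (by omega) (by omega) (by unfold CrossBefore; omega)) hi hj hl
  have doubleFan : ∀ s, s + 1 < r → m = s + 2 * r - 1 → False := by
    intro s hs hms
    subst hms
    have k₁ : crossRank r s = 3 * s := if_pos (by omega)
    have k₂ : crossRank r (s + 1) = 3 * (s + 1) := if_pos hs
    have k₃ : crossRank r (s + r) = 3 * s + 1 := by unfold crossRank; split_ifs <;> omega
    have k₄ : crossRank r (s + 2 * r) = 3 * s + 2 := by unfold crossRank; split_ifs <;> omega
    have k₅ : (s = 0 ∧ crossRank r (s + 2 * r - 1) + 2 = 3 * r) ∨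
        (0 < s ∧ crossRank r (s + 2 * r - 1) + 1 = 3 * s) := by
      unfold crossRank; split_ifs <;> omega
    obtain ⟨i, hi⟩ := hgap s s (s + 1) (by omega) (by omega) (by omega)
      (by unfold CrossBefore; omega)
      (fun c _ _ _ _ => by unfold CrossBefore; rcases crossRank_cases r c with h | h | h <;> omega)
    obtain ⟨j, hj⟩ := hgap (s + 1) (s + r) (s + 1) (by omega) (by omega) (by omega)
      (by unfold CrossBefore; omega)
      (fun c _ _ _ _ => by unfold CrossBefore; rcases crossRank_cases r c with h | h | h <;> omega)
    obtain ⟨l, hl⟩ := hgap (s + r) (s + 2 * r - 1) (s + r) (by omega) (by omega) (by omega)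
      (by unfold CrossBefore; omega)
      (fun c _ _ _ _ => by unfold CrossBefore; rcases crossRank_cases r c with h | h | h <;> omega)
    obtain ⟨o, ho⟩ := hgap (s + r + 1) (s + 2 * r - 1) (s + 2 * r) (by omega) (by omega) (by omega)
      (by unfold CrossBefore; omega)
      (fun c _ _ _ _ => by unfold CrossBefore; rcases crossRank_cases r c with h | h | h <;> omega)
    exact not_dyadic_double_fan (x := (v (s + 2 * r - 1)).val) (y₀ := (v s).val)
      (hlt (by omega) (by omega) (by unfold CrossBefore; omega)) (hlt (by omega) (by omega) (by unfold CrossBefore; omega))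
      (hlt (by omega) (by omega) (by unfold CrossBefore; omega)) (hlt (by omega) (by omega) (by unfold CrossBefore; omega)) hi hj hl ho
  by_cases h1 : m + 1 < r
  · exact zigzag (m + 1) h1 (by omega)
  by_cases h2 : m + 1 < 2 * r
  · exact zigzag (m + 1 - r) (by omega) (by omega)
  by_cases h3 : m = 3 * r - 2
  · exact zigzag 0 (by omega) (by omega)
  · exact doubleFan (m + 1 - 2 * r) (by omega) (by omega)

theorem card_dyadicGapSet_ge {n r q : ℕ} (hr : 2 ≤ r) (hq : q = n / 4) (hq0 : 0 < q)
    {H : Finset (Finset (Fin n))} (hH : ∀ e, IsDyadicGapSet n r e → e ∈ H) :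
    q * (Nat.log 2 q + 1) * (2 * q).choose (r - 2) ≤ H.card := by
  have : NeZero n := ⟨by omega⟩
  let U : Finset (Fin n) := Finset.univ.filter (fun x => 2 * q ≤ x.val)
  let T : Finset ((ℕ × ℕ) × Finset (Fin n)) :=
    (Finset.range q ×ˢ Finset.range (Nat.log 2 q + 1)) ×ˢ Finset.powersetCard (r - 2) U
  let f : (ℕ × ℕ) × Finset (Fin n) → Finset (Fin n) := fun t =>
    insert (Fin.ofNat n t.1.1) (insert (Fin.ofNat n (t.1.1 + 2 ^ t.1.2)) t.2)
  have hU : 2 * q ≤ U.card := by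
    have h1 := Finset.card_filter_add_card_filter_not (s := (Finset.univ : Finset (Fin n)))
      (fun x => 2 * q ≤ x.val)
    have h2 : (Finset.univ.filter (fun x : Fin n => ¬ 2 * q ≤ x.val)).card ≤ 2 * q := by
      calc _ ≤ (Finset.range (2 * q)).card :=
            Finset.card_le_card_of_injOn Fin.val (by intro x hx; simpa using hx)
              (Fin.val_injective.injOn)
        _ = 2 * q := by simp
    have h3 : U.card = (Finset.univ.filter (fun x : Fin n => 2 * q ≤ x.val)).card := rfl
    simp only [Finset.card_univ, Fintype.card_fin] at h1
    omega
  have hT : ∀ a p S, ((a, p), S) ∈ T → a < q ∧ 2 ^ p ≤ q ∧ (∀ x ∈ S, 2 * q ≤ x.val) ∧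
      S.card = r - 2 ∧ (Fin.ofNat n a).val = a ∧ (Fin.ofNat n (a + 2 ^ p)).val = a + 2 ^ p := by
    intro a p S h
    simp only [T, Finset.mem_product, Finset.mem_range, Finset.mem_powersetCard] at h
    obtain ⟨⟨ha, hp⟩, hS, hc⟩ := h
    have hp' : 2 ^ p ≤ q := Nat.pow_le_of_le_log (by omega) (by omega)
    refine ⟨ha, hp', fun x hx => ?_, hc, ?_, ?_⟩
    · simpa [U] using hS hx
    · exact Nat.mod_eq_of_lt (by omega)
    · exact Nat.mod_eq_of_lt (by omega)
  calc q * (Nat.log 2 q + 1) * (2 * q).choose (r - 2) ≤ T.card := by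
        simp only [T, Finset.card_product, Finset.card_range, Finset.card_powersetCard]
        gcongr
    _ ≤ H.card := by
        refine Finset.card_le_card_of_injOn f ?_ ?_
        · rintro ⟨⟨a, p⟩, S⟩ ht
          obtain ⟨ha, hp, hS, hc, va, vb⟩ := hT a p S ht
          have hpos : 0 < 2 ^ p := by positivity
          refine hH _ ⟨?_, Fin.ofNat n a, by simp [f], Fin.ofNat n (a + 2 ^ p), by simp [f],
            ?_, ?_, p, by omega, by omega⟩
          · simp only [f]
            rw [Finset.card_insert_of_notMem, Finset.card_insert_of_notMem, hc]
            · omega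
            · intro h; have := hS _ h; omega
            · intro h
              rcases Finset.mem_insert.1 h with h | h
              · have := congrArg Fin.val h; omega
              · have := hS _ h; omega
          · intro c hc
            simp only [f, Finset.mem_insert] at hc
            rw [Fin.le_def]
            rcases hc with rfl | rfl | h
            · exact le_rfl
            · omega
            · have := hS _ h; omega
          · intro c hc hne
            simp only [f, Finset.mem_insert] at hc
            rw [Fin.le_def]
            rcases hc with rfl | rfl | h
            · exact absurd rfl hne
            · exact le_rfl
            · have := hS _ h; omega
        · rintro ⟨⟨a, p⟩, S⟩ ht ⟨⟨a', p'⟩, S'⟩ ht' hff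
          obtain ⟨ha, hp, hS, -, va, vb⟩ := hT a p S ht
          obtain ⟨ha', hp', hS', -, va', vb'⟩ := hT a' p' S' ht'
          have hpos : 0 < 2 ^ p := by positivity
          have hpos' : 0 < 2 ^ p' := by positivity
          simp only [f, Finset.ext_iff, Finset.mem_insert, Fin.ext_iff, va, vb, va', vb'] at hff
          have small : ∀ x : Fin n, x.val < 2 * q →
              ((x.val = a ∨ x.val = a + 2 ^ p) ↔ (x.val = a' ∨ x.val = a' + 2 ^ p')) := by
            intro x hx
            have h1 : x ∉ S := fun h => by have := hS x h; omega
            have h2 : x ∉ S' := fun h => by have := hS' x h; omega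
            have := hff x
            simpa [h1, h2] using this
          have e1 := small (Fin.ofNat n a) (by omega)
          have e2 := small (Fin.ofNat n (a + 2 ^ p)) (by omega)
          have e3 := small (Fin.ofNat n a') (by omega)
          rw [va] at e1
          rw [vb] at e2
          rw [va'] at e3
          have haa : a = a' := by omega
          have hpp : 2 ^ p = 2 ^ p' := by omega
          have hSS : S = S' := by
            ext x
            by_cases hx : x.val < 2 * q
            · exact ⟨fun h => by have := hS x h; omega, fun h => by have := hS' x h; omega⟩
            · have h1 : x.val ≠ a := by omega
              have h2 : x.val ≠ a + 2 ^ p := by omega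
              have h3 : x.val ≠ a' := by omega
              have h4 : x.val ≠ a' + 2 ^ p' := by omega
              simpa [h1, h2, h3, h4] using hff x
          rw [haa, Nat.pow_right_injective (le_refl 2) hpp, hSS]

theorem card_le_exCycP {n r k : ℕ} {H : Finset (Finset (Fin n))} (hr : ∀ e ∈ H, e.card = r)
    (hH : ¬ ∃ v : ℕ → Fin n, IsCycCrossPath r k H v) : H.card ≤ exCycP n r k :=
  le_csSup ⟨Fintype.card (Finset (Fin n)), by
    rintro _ ⟨H', -, -, rfl⟩
    exact Finset.card_le_univ H'⟩ ⟨H, hr, hH, rfl⟩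

theorem pow_mul_log_le_mul_choose {n r : ℕ} (hr : 2 ≤ r) (hn : 64 + 4 * r ≤ n) :
    (1 / 8 : ℝ) ^ (r - 1) / 2 / (r - 2).factorial * (n : ℝ) ^ (r - 1) * Real.log n ≤
      ((n / 4 * (Nat.log 2 (n / 4) + 1) * (2 * (n / 4)).choose (r - 2) : ℕ) : ℝ) := by
  generalize hq : n / 4 = q
  have hqr : r ≤ q := by omega
  have hq8 : (n : ℝ) / 8 ≤ q := by
    have : n ≤ 8 * q := by omega
    have : (n : ℝ) ≤ 8 * q := by exact_mod_cast this
    linarith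
  have hn64 : (64 : ℝ) ≤ n := by exact_mod_cast (by omega : 64 ≤ n)
  have hq0 : (0 : ℝ) < q := by linarith
  have hfac : (0 : ℝ) < (r - 2).factorial := by exact_mod_cast Nat.factorial_pos _
  have hlogn : 0 ≤ Real.log n := Real.log_nonneg (by linarith)
  have hlog : Real.log n / 2 ≤ (Nat.log 2 q + 1 : ℕ) := by
    have h1 : Real.log n / 2 ≤ Real.log q := by
      have h64 : (n : ℝ) ≤ (q : ℝ) ^ 2 := by nlinarith
      have := Real.log_le_log (by linarith) h64
      rw [Real.log_pow] at this
      push_cast at this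
      linarith
    have h2 : (q : ℝ) ≤ 2 ^ (Nat.log 2 q + 1) := by
      exact_mod_cast (Nat.lt_pow_succ_log_self (by norm_num) q).le
    have h3 := Real.log_le_log hq0 h2
    rw [Real.log_pow] at h3
    have h4 : Real.log 2 ≤ 1 := by linarith [Real.log_two_lt_d9]
    have h5 : (0 : ℝ) ≤ (Nat.log 2 q + 1 : ℕ) := by positivity
    nlinarith
  have hchoose : (q : ℝ) ^ (r - 2) ≤ (r - 2).factorial * (2 * q).choose (r - 2) := by
    have h1 : ((2 * q + 1 - (r - 2) : ℕ) : ℝ) ^ (r - 2) ≤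
        (r - 2).factorial * (2 * q).choose (r - 2) := by
      exact_mod_cast Nat.pow_sub_le_descFactorial (2 * q) (r - 2) |>.trans_eq
        (Nat.descFactorial_eq_factorial_mul_choose _ _)
    refine le_trans ?_ h1
    gcongr
    omega
  have hpow : (1 / 8 : ℝ) ^ (r - 1) * (n : ℝ) ^ (r - 1) ≤ q * (q : ℝ) ^ (r - 2) := by
    rw [← mul_pow, ← pow_succ', show r - 2 + 1 = r - 1 by omega]
    gcongr
    linarith
  push_cast at hlog ⊢
  calc (1 / 8 : ℝ) ^ (r - 1) / 2 / (r - 2).factorial * (n : ℝ) ^ (r - 1) * Real.log n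
      = ((1 / 8 : ℝ) ^ (r - 1) * (n : ℝ) ^ (r - 1)) * (Real.log n / 2) / (r - 2).factorial := by
        ring
    _ ≤ (q * ((r - 2).factorial * (2 * q).choose (r - 2))) * (Nat.log 2 q + 1) /
          (r - 2).factorial := by
        have := hpow.trans (mul_le_mul_of_nonneg_left hchoose hq0.le)
        gcongr
    _ = q * (Nat.log 2 q + 1) * (2 * q).choose (r - 2) := by
        field_simp

/-- Let `r ≥ 2` and `n > 20r`. The family `G(n,r,r+2)` of all `r`-sets
`{a₁ < a₂ < ... < a_r}` (inequalities as integers) with `a₂ − a₁ = 2^p` for some `p` with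
`2^p ≤ n/4`, viewed as a cg `r`-graph, contains no crossing `2r`-path `P_{2r}^r`.
Consequently, for every fixed `k ≥ 2r ≥ 4` there is `c > 0` such that
`ex_↻(n, P_k^r) ≥ c·n^(r−1)·log n` for all sufficiently large `n`. -/
theorem stmt8 (r : ℕ) (hr : 2 ≤ r) :
    (∀ n : ℕ, 20 * r < n → ∀ H : Finset (Finset (Fin n)),
      (∀ e : Finset (Fin n), e ∈ H ↔ (e.card = r ∧ ∃ a ∈ e, ∃ b ∈ e,
          (∀ c ∈ e, a ≤ c) ∧ (∀ c ∈ e, c ≠ a → b ≤ c) ∧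
          ∃ p : ℕ, (b : ℕ) - (a : ℕ) = 2 ^ p ∧ 2 ^ p ≤ n / 4)) →
      ¬ ∃ v : ℕ → Fin n, IsCycCrossPath r (2 * r) H v) ∧
    (∀ k : ℕ, 2 * r ≤ k → ∃ c : ℝ, 0 < c ∧ ∃ N : ℕ, ∀ n : ℕ, N ≤ n →
      c * (n : ℝ) ^ (r - 1) * Real.log n ≤ exCycP n r k) := by
  refine ⟨fun n _ H hH => fun ⟨v, hv⟩ =>
    not_isCycCrossPath_of_isDyadicGapSet hr le_rfl (fun e he => (hH e).1 he) v hv, ?_⟩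
  intro k hk
  refine ⟨(1 / 8 : ℝ) ^ (r - 1) / 2 / (r - 2).factorial, by positivity, 64 + 4 * r, ?_⟩
  intro n hn
  classical
  let H : Finset (Finset (Fin n)) := Finset.univ.filter (IsDyadicGapSet n r)
  have hH : ∀ e, e ∈ H ↔ IsDyadicGapSet n r e := by simp [H]
  refine (pow_mul_log_le_mul_choose hr hn).trans (Nat.cast_le.2 ?_)
  exact (card_dyadicGapSet_ge hr rfl (by omega) fun e he => (hH e).2 he).trans
    (card_le_exCycP (fun e he => ((hH e).1 he).1) fun ⟨v, hv⟩ =>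
      not_isCycCrossPath_of_isDyadicGapSet hr hk (fun e he => (hH e).1 he) v hv)
end

section
/- Let r ≥ 2 and 1 ≤ k ≤ r, and let H be a cg r-graph on Ω_n. Define T_k(H) to be the set of all r-tuples (v_k, v_{k+1}, ..., v_{r+k−1}) of vertices for which there exist vertices v_1, ..., v_{k−1} such that all k sets e_i = {v_i, v_{i+1}, ..., v_{i+r−1}} (1 ≤ i ≤ k) are edges of H and the clockwise cyclic order of the vertices is v_1 < v_{r+1} < v_2 < v_{r+2} < ... < v_{k−1} < v_{r+k−1} < v_k < v_{k+1} < ... < v_r (< v_1), i.e., v_1 v_2 ... v_{r+k−1} is a crossing k-path in H ending in the edge e_k. Then |T_k(H)| ≥ r · e(H) − (r−1)(k−1) · |∂H|. In particular, if H contains no crossing k-path P_k^r, then e(H) ≤ ((k−1)(r−1)/r) · |∂H| ≤ ((k−1)(r−1)/r) · C(n, r−1). -/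
/-- Changing the base point of clockwise distances from `o` to `a`. -/
theorem Fin.val_sub_eq_ite_base {n : ℕ} (o a b : Fin n) :
    (b - a).val = if (a - o).val ≤ (b - o).val then (b - o).val - (a - o).val
      else n + (b - o).val - (a - o).val := by
  have ha := a.isLt
  have hb := b.isLt
  have ho := o.isLt
  rw [Fin.val_sub_eq_ite b a, Fin.val_sub_eq_ite a o, Fin.val_sub_eq_ite b o]
  split_ifs <;> omega

/-- A simplified description of crossing `k`-paths for `k ≤ r`. -/
structure IsShortCrossPath (r k : ℕ) {n : ℕ} (H : Finset (Finset (Fin n))) (v : ℕ → Fin n) :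
    Prop where
  edge_mem : ∀ i < k, Finset.image v (Finset.Ico i (i + r)) ∈ H
  cycChain : CycChain r v
  ne : ∀ j, j + 1 < k → v j ≠ v (j + r)
  lt : ∀ j, j + 1 < k → v (j + r) - v j < v (j + 1) - v j

namespace IsShortCrossPath

variable {r k n : ℕ} {H : Finset (Finset (Fin n))} {v : ℕ → Fin n}

theorem dist_lt (h : IsShortCrossPath r k H v) {i j : ℕ} (hij : i < j) (hj : j < r) :
    (v i - v 0).val < (v j - v 0).val :=
  h.cycChain i j hij hj

theorem dist_le (h : IsShortCrossPath r k H v) {i j : ℕ} (hij : i ≤ j) (hj : j < r) :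
    (v i - v 0).val ≤ (v j - v 0).val := by
  rcases hij.eq_or_lt with rfl | hij
  · exact le_rfl
  · exact (h.dist_lt hij hj).le

theorem dist_between (h : IsShortCrossPath r k H v) (hkr : k ≤ r) {j : ℕ} (hj : j + 1 < k) :
    (v j - v 0).val < (v (j + r) - v 0).val ∧
      (v (j + r) - v 0).val < (v (j + 1) - v 0).val := by
  have h1 := h.dist_lt (Nat.lt_succ_self j) (by omega : j + 1 < r)
  have h2 : (v (j + r) - v j).val < (v (j + 1) - v j).val := h.lt j hj
  have h3 : (v j - v 0).val ≠ (v (j + r) - v 0).val := fun he => by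
    have := Fin.val_sub_eq_ite_base (v 0) (v j) (v (j + r))
    rw [if_pos he.le, he, Nat.sub_self, Fin.val_sub_eq_ite] at this
    have hlt := (v j).isLt
    apply h.ne j hj
    apply Fin.ext
    split_ifs at this <;> omega
  rw [Fin.val_sub_eq_ite_base (v 0) (v j) (v (j + r)),
    Fin.val_sub_eq_ite_base (v 0) (v j) (v (j + 1))] at h2
  have h4 := (v (j + r) - v 0).isLt
  have h5 := (v (j + 1) - v 0).isLt
  rw [Nat.succ_eq_add_one] at h1
  split_ifs at h2 <;> omega

theorem injective (h : IsShortCrossPath r k H v) (hkr : k ≤ r) {i j : ℕ} (hij : i < j)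
    (hj : j < k + r - 1) : v i ≠ v j := by
  intro he
  have he : (v i - v 0).val = (v j - v 0).val := by rw [he]
  rcases lt_or_ge j r with hjr | hjr
  · exact (h.dist_lt hij hjr).ne he
  obtain ⟨b, rfl⟩ := Nat.exists_eq_add_of_le' hjr
  have hb := h.dist_between hkr (j := b) (by omega)
  rcases lt_or_ge i r with hir | hir
  · rcases le_or_gt i b with hib | hib
    · have := h.dist_le hib (by omega)
      omega
    · have := h.dist_le (Nat.succ_le_of_lt hib) hir
      rw [Nat.succ_eq_add_one] at this
      omega
  · obtain ⟨a, rfl⟩ := Nat.exists_eq_add_of_le' hir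
    have ha := h.dist_between hkr (j := a) (by omega)
    have := h.dist_le (by omega : a + 1 ≤ b) (by omega)
    omega

/-- The last `r` vertices of a crossing path are cyclically ordered. -/
theorem window_lt (h : IsShortCrossPath r k H v) (hk : 1 ≤ k) (hkr : k ≤ r) {i j : ℕ}
    (hij : i < j) (hj : j < r) :
    v (k - 1 + i) - v (k - 1) < v (k - 1 + j) - v (k - 1) := by
  rw [Fin.lt_def, Fin.val_sub_eq_ite_base (v 0) (v (k - 1)) (v (k - 1 + i)),
    Fin.val_sub_eq_ite_base (v 0) (v (k - 1)) (v (k - 1 + j))]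
  have hi1 := (v (k - 1 + i) - v 0).isLt
  have hk1 := (v (k - 1) - v 0).isLt
  rcases lt_or_ge (k - 1 + j) r with hjr | hjr
  · have h1 := h.dist_lt (by omega : k - 1 + i < k - 1 + j) hjr
    have h2 := h.dist_le (by omega : k - 1 ≤ k - 1 + i) (by omega)
    split_ifs <;> omega
  obtain ⟨b, hb⟩ := Nat.exists_eq_add_of_le' hjr
  have hb' := h.dist_between hkr (j := b) (by omega)
  have hbk := h.dist_le (by omega : b + 1 ≤ k - 1) (by omega)
  rw [hb]
  rcases lt_or_ge (k - 1 + i) r with hir | hir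
  · have h2 := h.dist_le (by omega : k - 1 ≤ k - 1 + i) (by omega)
    split_ifs <;> omega
  · obtain ⟨a, ha⟩ := Nat.exists_eq_add_of_le' hir
    have ha' := h.dist_between hkr (j := a) (by omega)
    have hab := h.dist_le (by omega : a + 1 ≤ b) (by omega)
    rw [ha] at hi1 ⊢
    split_ifs <;> omega

/-- A crossing path is extended by a vertex strictly between `v (k - 1)` and `v k`. -/
theorem extend (h : IsShortCrossPath r k H v) (hk : 1 ≤ k) (hkr : k < r) {x : Fin n}
    (hne : v (k - 1) ≠ x) (hlt : x - v (k - 1) < v k - v (k - 1))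
    (hedge : insert x (Finset.image v (Finset.Ico k (k + r - 1))) ∈ H) :
    IsShortCrossPath r (k + 1) H (Function.update v (k + r - 1) x) := by
  have hu : ∀ i, i ≠ k + r - 1 → Function.update v (k + r - 1) x i = v i := fun i hi =>
    Function.update_of_ne hi _ _
  have himage : ∀ a b, b ≤ k + r - 1 →
      Finset.image (Function.update v (k + r - 1) x) (Finset.Ico a b)
        = Finset.image v (Finset.Ico a b) := fun a b hb =>
    Finset.image_congr fun i hi => hu i (by have := Finset.mem_Ico.1 hi; omega)
  refine ⟨fun i hi => ?_, fun i j hij hj => ?_, fun j hj => ?_, fun j hj => ?_⟩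
  · rcases Nat.lt_succ_iff_lt_or_eq.1 hi with hi | rfl
    · rw [himage _ _ (by omega)]
      exact h.edge_mem i hi
    · rw [show i + r = (i + r - 1) + 1 by omega, ← Finset.insert_Ico_right_eq_Ico_add_one (by omega),
        Finset.image_insert, show i + r - 1 + 1 - 1 = i + r - 1 by omega,
        himage _ _ le_rfl, Function.update_self]
      exact hedge
  · rw [hu i (by omega), hu j (by omega), hu 0 (by omega)]
    exact h.cycChain i j hij hj
  · rcases Nat.lt_succ_iff_lt_or_eq.1 hj with hj | hj
    · rw [hu _ (by omega), hu _ (by omega)]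
      exact h.ne j hj
    · rw [show j + r = k + r - 1 by omega, Function.update_self, hu _ (by omega),
        show j = k - 1 by omega]
      exact hne
  · rcases Nat.lt_succ_iff_lt_or_eq.1 hj with hj | hj
    · rw [hu _ (by omega), hu _ (by omega), hu _ (by omega)]
      exact h.lt j hj
    · rw [show j + r = k + r - 1 by omega, Function.update_self, hu _ (by omega),
        hu _ (by omega), hj, show j = k - 1 by omega]
      exact hlt

end IsShortCrossPath

theorem isCycCrossPath_iff_isShortCrossPath {r k n : ℕ} (hr : 2 ≤ r) (hk : 1 ≤ k) (hkr : k ≤ r)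
    {H : Finset (Finset (Fin n))} {v : ℕ → Fin n} :
    IsCycCrossPath r k H v ↔ IsShortCrossPath r k H v := by
  have pos_of_ne : ∀ a b : Fin n, a ≠ b → a - a < b - a := fun a b hab => by
    have ha := a.isLt
    have hb := b.isLt
    have hab' : a.val ≠ b.val := fun he => hab (Fin.ext he)
    rw [Fin.lt_def, Fin.val_sub_eq_ite, Fin.val_sub_eq_ite]
    split_ifs <;> omega
  have div_one : ∀ j, j + 1 < k → (k + r - 2 - j) / r = 1 := fun j hj =>
    Nat.div_eq_of_lt_le (by omega) (by omega)
  constructor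
  · rintro ⟨-, hedge, hchain, hbetween, -⟩
    refine ⟨hedge, hchain, fun j hj he => ?_, fun j hj => ?_⟩
    · have := hbetween j (by omega) 0 1 one_pos (by rw [div_one j hj]; omega)
      simp [div_one j hj, he] at this
    · have := hbetween j (by omega) 1 2 one_lt_two (by rw [div_one j hj]; omega)
      simpa [div_one j hj] using this
  · intro h
    refine ⟨fun i j hi hj he => ?_, h.edge_mem, h.cycChain, fun j hj => ?_, ?_⟩
    · rcases lt_trichotomy i j with hij | hij | hij
      · exact (h.injective hkr hij hj he).elim
      · exact hij
      · exact (h.injective hkr hij hi he.symm).elim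
    · have hpos := pos_of_ne _ _ (h.injective hkr (Nat.lt_succ_self j) (by omega))
      rcases lt_or_ge (j + 1) k with hjk | hjk
      · have hpos' := pos_of_ne _ _ (h.ne j hjk)
        have hlt := h.lt j hjk
        rw [div_one j hjk]
        intro a b hab hb
        obtain ⟨rfl, rfl⟩ | ⟨rfl, rfl⟩ | ⟨rfl, rfl⟩ :
            (a = 0 ∧ b = 1) ∨ (a = 0 ∧ b = 2) ∨ (a = 1 ∧ b = 2) := by omega
        · simpa using hpos'
        · simpa using hpos
        · simpa using hlt
      · rw [Nat.div_eq_of_lt (by omega : k + r - 2 - j < r)]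
        intro a b hab hb
        obtain ⟨rfl, rfl⟩ : a = 0 ∧ b = 1 := by omega
        simpa using hpos
    · have hpos := pos_of_ne _ _ (h.injective hkr (by omega : 0 < r - 1) (by omega))
      have hle : (k + r - 2) / r < 2 := Nat.div_lt_of_lt_mul (by omega)
      intro a b hab hb
      obtain ⟨rfl, rfl⟩ : a = 0 ∧ b = 1 := by omega
      simpa using hpos

/-- The tuples formed by the last `r` vertices of the short crossing `k`-paths of `H`. -/
def endTuples (r k : ℕ) {n : ℕ} (H : Finset (Finset (Fin n))) : Set (Fin r → Fin n) :=
  {w | ∃ v : ℕ → Fin n, IsShortCrossPath r k H v ∧ ∀ j : Fin r, w j = v (k - 1 + (j : ℕ))}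

/-- The `m`-tuples of vertices in clockwise cyclic order whose set of entries lies in `S`. -/
def cycTuples (m : ℕ) {n : ℕ} (S : Finset (Finset (Fin n))) : Set (Fin (m + 1) → Fin n) :=
  {f | StrictMono (fun i => f i - f 0) ∧ Finset.image f Finset.univ ∈ S}

section Counting

variable {m n : ℕ}

theorem injective_of_strictMono_sub {f : Fin (m + 1) → Fin n}
    (hf : StrictMono (fun i => f i - f 0)) : Function.Injective f := fun i j hij =>
  hf.injective (by simp only [hij])

theorem ncard_cycTuples_le (S : Finset (Finset (Fin n))) (hS : ∀ s ∈ S, s.card = m + 1) :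
    (cycTuples m S).ncard ≤ (m + 1) * S.card := by
  have hcard : (S.sigma fun s => s).card = (m + 1) * S.card := by
    rw [Finset.card_sigma, Finset.sum_congr rfl hS, Finset.sum_const, smul_eq_mul, mul_comm]
  rw [← hcard, ← Set.ncard_coe_finset]
  refine Set.ncard_le_ncard_of_injOn
    (fun f => (⟨Finset.image f Finset.univ, f 0⟩ : Σ _ : Finset (Fin n), Fin n))
    (fun f hf => ?_) (fun f hf g hg hfg => ?_) (Finset.finite_toSet _)
  · simpa using hf.2
  · simp only [Sigma.mk.injEq, heq_eq_eq] at hfg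
    obtain ⟨himage, h0⟩ := hfg
    have hrange : Set.range f = Set.range g := by
      simpa using congrArg (fun s : Finset (Fin n) => (s : Set (Fin n))) himage
    have : NeZero n := ⟨fun hn => by subst hn; exact (f 0).elim0⟩
    have hsub : (fun i => f i - f 0) = fun i => g i - g 0 := by
      refine (hf.1.range_inj hg.1).1 ?_
      change Set.range ((fun x => x - f 0) ∘ f) = Set.range ((fun x => x - g 0) ∘ g)
      rw [Set.range_comp, Set.range_comp, hrange, h0]
    funext i
    have := congrFun hsub i
    simp only [h0] at this
    exact sub_left_injective this

theorem le_ncard_cycTuples (S : Finset (Finset (Fin n))) (hS : ∀ s ∈ S, s.card = m + 1) :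
    (m + 1) * S.card ≤ (cycTuples m S).ncard := by
  have hcard : (S.sigma fun s => s).card = (m + 1) * S.card := by
    rw [Finset.card_sigma, Finset.sum_congr rfl hS, Finset.sum_const, smul_eq_mul, mul_comm]
  rw [← hcard, ← Set.ncard_coe_finset]
  have hex : ∀ p : (Σ _ : Finset (Fin n), Fin n), ∃ f, p ∈ (S.sigma fun s => s) →
      f ∈ cycTuples m S ∧ Finset.image f Finset.univ = p.1 ∧ f 0 = p.2 := by
    rintro ⟨s, a⟩
    by_cases hp : (⟨s, a⟩ : Σ _ : Finset (Fin n), Fin n) ∈ S.sigma fun s => s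
    swap
    · exact ⟨fun _ => a, fun h => (hp h).elim⟩
    obtain ⟨hs, ha⟩ : s ∈ S ∧ a ∈ s := by simpa using hp
    have : NeZero n := ⟨fun hn => by subst hn; exact a.elim0⟩
    set s' := Finset.image (fun x => x - a) s with hs'
    have hcs' : s'.card = m + 1 := by
      rw [hs', Finset.card_image_of_injective _ sub_left_injective, hS s hs]
    let φ := s'.orderEmbOfFin hcs'
    have hφ0 : φ 0 = 0 := by
      have h0 : (0 : Fin n) ∈ Set.range φ := by
        rw [Finset.range_orderEmbOfFin]
        exact Finset.mem_image.2 ⟨a, ha, sub_self a⟩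
      obtain ⟨i, hi⟩ := h0
      exact le_antisymm (hi ▸ φ.monotone (Fin.zero_le i)) (Fin.zero_le _)
    have himage : Finset.image (fun i => φ i + a) Finset.univ = s := by
      have h1 : Finset.image φ Finset.univ = s' := Finset.image_orderEmbOfFin_univ s' hcs'
      rw [show (fun i => φ i + a) = (fun x => x + a) ∘ φ from rfl, ← Finset.image_image, h1, hs',
        Finset.image_image]
      simp [Function.comp_def]
    refine ⟨fun i => φ i + a, fun _ => ⟨⟨?_, himage ▸ hs⟩, himage, by simp [hφ0]⟩⟩
    simpa [hφ0] using φ.strictMono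
  choose F hF using hex
  refine Set.ncard_le_ncard_of_injOn F (fun p hp => (hF p hp).1)
    (fun p hp q hq hpq => ?_) (Set.toFinite _)
  apply Sigma.ext
  · rw [← (hF p hp).2.1, ← (hF q hq).2.1, hpq]
  · rw [← (hF p hp).2.2, ← (hF q hq).2.2, hpq]

theorem cycTuples_subset_endTuples_one (H : Finset (Finset (Fin n))) :
    cycTuples m H ⊆ endTuples (m + 1) 1 H := by
  rintro f ⟨hf, hH⟩
  have hofNat : ∀ j (hj : j < m + 1), Fin.ofNat (m + 1) j = ⟨j, hj⟩ := fun j hj =>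
    Fin.ext (Nat.mod_eq_of_lt hj)
  refine ⟨fun i => f (Fin.ofNat (m + 1) i), ⟨fun i hi => ?_, fun i j hij hj => ?_,
    fun j hj => by omega, fun j hj => by omega⟩, fun j => ?_⟩
  · obtain rfl : i = 0 := by omega
    convert hH using 1
    ext x
    simp only [Finset.mem_image, Finset.mem_Ico, Finset.mem_univ, true_and]
    constructor
    · rintro ⟨a, -, rfl⟩
      exact ⟨_, rfl⟩
    · rintro ⟨a, rfl⟩
      exact ⟨a, ⟨Nat.zero_le _, by omega⟩, by rw [hofNat a a.isLt]⟩
  · rw [hofNat i (hij.trans hj), hofNat j hj]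
    exact hf (Fin.mk_lt_mk.2 hij)
  · simp only [Nat.sub_self, zero_add]
    rw [hofNat j j.isLt]

theorem tail_mem_cycTuples {k : ℕ} (hk : 1 ≤ k) (hkr : k ≤ m + 2) {H S : Finset (Finset (Fin n))}
    (hS : ∀ s : Finset (Fin n), s.card = m + 1 → (∃ e ∈ H, s ⊆ e) → s ∈ S)
    {w : Fin (m + 2) → Fin n} (hw : w ∈ endTuples (m + 2) k H) :
    Fin.tail w ∈ cycTuples m S := by
  obtain ⟨v, hv, hwv⟩ := hw
  have hlt : ∀ i j : Fin (m + 2), i < j → (w i - w 0).val < (w j - w 0).val := fun i j hij => by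
    rw [hwv i, hwv j, hwv 0]
    exact hv.window_lt hk hkr hij j.isLt
  have hmono : StrictMono fun i => Fin.tail w i - Fin.tail w 0 := fun i j hij => by
    change (w i.succ - w (0 : Fin (m + 1)).succ).val < (w j.succ - w (0 : Fin (m + 1)).succ).val
    have h1 := hlt _ _ (Fin.succ_lt_succ_iff.2 hij)
    have h2 : (w (0 : Fin (m + 1)).succ - w 0).val ≤ (w i.succ - w 0).val := by
      rcases (Fin.zero_le i).eq_or_lt with h | h
      · rw [← h]
      · exact (hlt _ _ (Fin.succ_lt_succ_iff.2 h)).le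
    rw [Fin.val_sub_eq_ite_base (w 0) _ (w i.succ), Fin.val_sub_eq_ite_base (w 0) _ (w j.succ)]
    split_ifs <;> omega
  refine ⟨hmono, hS _ ?_ ⟨_, hv.edge_mem (k - 1) (by omega), ?_⟩⟩
  · rw [Finset.card_image_of_injective _ (injective_of_strictMono_sub hmono), Finset.card_univ,
      Fintype.card_fin]
  · intro x hx
    obtain ⟨i, -, rfl⟩ := Finset.mem_image.1 hx
    refine Finset.mem_image.2 ⟨k - 1 + (i.succ : ℕ), Finset.mem_Ico.2 ⟨by omega, by omega⟩, ?_⟩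
    exact (hwv i.succ).symm

/-- Of two end tuples that differ only in their first vertex, the later first vertex can be
appended to the path ending in the other tuple. -/
theorem snoc_mem_endTuples {k : ℕ} (hk : 1 ≤ k) (hkr : k < m + 2) {H : Finset (Finset (Fin n))}
    {w w' : Fin (m + 2) → Fin n} (hw : w ∈ endTuples (m + 2) k H)
    (hw' : w' ∈ endTuples (m + 2) k H) (htail : Fin.tail w = Fin.tail w')
    (hlt : w 1 - w' 0 < w 1 - w 0) :
    (Fin.snoc (Fin.tail w') (w' 0) : Fin (m + 2) → Fin n) ∈ endTuples (m + 2) (k + 1) H := by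
  obtain ⟨v, hv, hwv⟩ := hw
  obtain ⟨v', hv', hwv'⟩ := hw'
  have h0 : w 0 = v (k - 1) := hwv 0
  have h1 : w 1 = v k := by
    rw [hwv 1, Fin.val_one, Nat.sub_add_cancel hk]
  have h0' : w' 0 = v' (k - 1) := hwv' 0
  have hagree : ∀ i, i < m + 1 → v (k + i) = v' (k + i) := fun i hi => by
    have := congrFun htail ⟨i, hi⟩
    simp only [Fin.tail] at this
    rw [hwv, hwv'] at this
    simpa [show k - 1 + (i + 1) = k + i by omega] using this
  have hne1 : v' (k - 1) ≠ v k := by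
    have := hagree 0 (by omega)
    rw [add_zero] at this
    rw [this]
    exact hv'.injective hkr.le (by omega) (by omega)
  rw [h0, h1, h0', Fin.lt_def, Fin.val_sub_eq_ite, Fin.val_sub_eq_ite] at hlt
  have hb1 := (v k).isLt
  have hb2 := (v (k - 1)).isLt
  have hb3 := (v' (k - 1)).isLt
  have hne1' : (v' (k - 1)).val ≠ (v k).val := fun h => hne1 (Fin.ext h)
  refine ⟨_, hv.extend hk hkr (x := v' (k - 1)) ?_ ?_ ?_, ?_⟩
  · intro he
    rw [he] at hlt
    exact lt_irrefl _ hlt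
  · rw [Fin.lt_def, Fin.val_sub_eq_ite, Fin.val_sub_eq_ite]
    split_ifs at hlt ⊢ <;> omega
  · have himage : Finset.image v (Finset.Ico k (k + (m + 2) - 1))
        = Finset.image v' (Finset.Ico k (k + (m + 2) - 1)) := Finset.image_congr fun i hi => by
      have hi := Finset.mem_Ico.1 hi
      have := hagree (i - k) (by omega)
      rwa [Nat.add_sub_cancel' hi.1] at this
    have hedge := hv'.edge_mem (k - 1) (by omega)
    rw [← Finset.insert_Ico_add_one_left_eq_Ico (by omega), Finset.image_insert,
      Nat.sub_add_cancel hk, show k - 1 + (m + 2) = k + (m + 2) - 1 by omega] at hedge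
    rwa [himage]
  · intro j
    refine Fin.lastCases ?_ (fun i => ?_) j
    · rw [Fin.snoc_last, Fin.val_last, show k + 1 - 1 + (m + 1) = k + (m + 2) - 1 by omega,
        Function.update_self, h0']
    · rw [Fin.snoc_castSucc, Fin.val_castSucc, Function.update_of_ne (by omega), Nat.add_sub_cancel,
        hagree i i.isLt, Fin.tail, hwv', Fin.val_succ]
      congr 1
      omega

theorem ncard_endTuples_le_succ {k : ℕ} (hk : 1 ≤ k) (hkr : k < m + 2)
    {H S : Finset (Finset (Fin n))} (hScard : ∀ s ∈ S, s.card = m + 1)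
    (hS : ∀ s : Finset (Fin n), s.card = m + 1 → (∃ e ∈ H, s ⊆ e) → s ∈ S) :
    (endTuples (m + 2) k H).ncard ≤
      (endTuples (m + 2) (k + 1) H).ncard + (m + 1) * S.card := by
  set shift : (Fin (m + 2) → Fin n) → Fin (m + 2) → Fin n :=
    fun w => Fin.snoc (Fin.tail w) (w 0) with hshift
  have hext : ∀ w w' : Fin (m + 2) → Fin n, Fin.tail w = Fin.tail w' → w 0 = w' 0 → w = w' :=
    fun w w' ht h0 => by rw [← Fin.cons_self_tail w, ← Fin.cons_self_tail w', ht, h0]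
  rw [← Set.ncard_inter_add_ncard_sdiff_eq_ncard (endTuples (m + 2) k H)
    (shift ⁻¹' endTuples (m + 2) (k + 1) H)]
  refine add_le_add ?_ (le_trans ?_ (ncard_cycTuples_le S hScard))
  · refine Set.ncard_le_ncard_of_injOn shift (fun w hw => hw.2) (fun w _ w' _ h => ?_)
      (Set.toFinite _)
    obtain ⟨ht, h0⟩ := Fin.snoc_inj.1 h
    exact hext w w' ht h0
  · refine Set.ncard_le_ncard_of_injOn Fin.tail
      (fun w hw => tail_mem_cycTuples hk hkr.le hS hw.1) (fun w hw w' hw' ht => ?_)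
      (Set.toFinite _)
    have h1 : w 1 = w' 1 := congrFun ht 0
    rcases lt_trichotomy (w 1 - w 0) (w 1 - w' 0) with hlt | heq | hlt
    · rw [h1] at hlt
      exact (hw.2 (snoc_mem_endTuples hk hkr hw'.1 hw.1 ht.symm hlt)).elim
    · have : NeZero n := ⟨fun hn => by subst hn; exact (w 0).elim0⟩
      exact hext w w' ht (sub_right_injective heq)
    · exact (hw'.2 (snoc_mem_endTuples hk hkr hw.1 hw'.1 ht hlt)).elim

theorem card_mul_le_ncard_endTuples {H S : Finset (Finset (Fin n))}
    (hH : ∀ e ∈ H, e.card = m + 2) (hScard : ∀ s ∈ S, s.card = m + 1)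
    (hS : ∀ s : Finset (Fin n), s.card = m + 1 → (∃ e ∈ H, s ⊆ e) → s ∈ S)
    {k : ℕ} (hk : 1 ≤ k) (hkr : k ≤ m + 2) :
    (m + 2) * H.card ≤ (endTuples (m + 2) k H).ncard + (k - 1) * ((m + 1) * S.card) := by
  induction k, hk using Nat.le_induction with
  | base =>
    rw [Nat.sub_self, zero_mul, add_zero]
    exact (le_ncard_cycTuples H hH).trans
      (Set.ncard_le_ncard (cycTuples_subset_endTuples_one H) (Set.toFinite _))
  | succ k hk ih =>
    have hstep := ncard_endTuples_le_succ hk hkr hScard hS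
    obtain ⟨j, rfl⟩ := Nat.exists_eq_add_of_le' hk
    have := ih (by omega)
    simp only [Nat.add_sub_cancel] at this ⊢
    rw [add_one_mul]
    omega

end Counting

/-- Let `r ≥ 2`, `1 ≤ k ≤ r` and let `H` be a cg `r`-graph on `Fin n`.
Let `T_k(H)` be the set of `r`-tuples of vertices that are the last `r` vertices
(in path order) of a crossing `k`-path in `H`, i.e. the ending edges of crossing `k`-paths.
Then `|T_k(H)| ≥ r·e(H) − (r−1)(k−1)·|∂H|`; in particular, if `H` has no crossing `k`-path,
then `e(H) ≤ ((k−1)(r−1)/r)·|∂H| ≤ ((k−1)(r−1)/r)·C(n,r−1)`. -/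
theorem stmt10 (r k n : ℕ) (hr : 2 ≤ r) (hk1 : 1 ≤ k) (hkr : k ≤ r)
    (H : Finset (Finset (Fin n))) (hcard : ∀ e ∈ H, e.card = r)
    (T : Set (Fin r → Fin n))
    (hT : T = {w | ∃ v : ℕ → Fin n, IsCycCrossPath r k H v ∧
      ∀ j : Fin r, w j = v (k - 1 + (j : ℕ))})
    (shadow : Finset (Finset (Fin n)))
    (hshadow : shadow =
      (Finset.powersetCard (r - 1) (Finset.univ : Finset (Fin n))).filter
        (fun f => ∃ e ∈ H, f ⊆ e)) :
    ((r : ℝ) * H.card - ((r : ℝ) - 1) * ((k : ℝ) - 1) * shadow.card ≤ (T.ncard : ℝ)) ∧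
    ((¬ ∃ v : ℕ → Fin n, IsCycCrossPath r k H v) →
      (H.card : ℝ) ≤ ((k : ℝ) - 1) * ((r : ℝ) - 1) / (r : ℝ) * shadow.card ∧
      (H.card : ℝ) ≤ ((k : ℝ) - 1) * ((r : ℝ) - 1) / (r : ℝ) * (n.choose (r - 1) : ℝ)) := by
  have hScard : ∀ s ∈ shadow, s.card = r - 1 := fun s hs => by
    rw [hshadow, Finset.mem_filter, Finset.mem_powersetCard] at hs
    exact hs.1.2
  have hS : ∀ s : Finset (Fin n), s.card = r - 1 → (∃ e ∈ H, s ⊆ e) → s ∈ shadow :=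
    fun s hs he => by
      rw [hshadow, Finset.mem_filter, Finset.mem_powersetCard]
      exact ⟨⟨Finset.subset_univ s, hs⟩, he⟩
  have hTend : T = endTuples r k H := by
    simp only [hT, endTuples, isCycCrossPath_iff_isShortCrossPath hr hk1 hkr]
  have hchoose : (shadow.card : ℝ) ≤ n.choose (r - 1) := by
    rw [hshadow]
    exact_mod_cast (Finset.card_filter_le _ _).trans (by simp)
  have hmain : (r : ℝ) * H.card - ((r : ℝ) - 1) * ((k : ℝ) - 1) * shadow.card ≤ T.ncard := by
    obtain ⟨m, rfl⟩ := Nat.exists_eq_add_of_le' hr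
    obtain ⟨j, rfl⟩ := Nat.exists_eq_add_of_le' hk1
    have h := card_mul_le_ncard_endTuples hcard hScard hS hk1 hkr
    rw [← hTend, Nat.add_sub_cancel] at h
    have h' : ((m : ℝ) + 2) * H.card ≤ T.ncard + j * ((m + 1) * shadow.card) := by
      exact_mod_cast h
    push_cast
    linarith
  refine ⟨hmain, fun hno => ?_⟩
  have hr0 : (0 : ℝ) < r := by positivity
  have hTempty : T = ∅ := by
    rw [hT, Set.eq_empty_iff_forall_notMem]
    rintro w ⟨v, hv, -⟩
    exact hno ⟨v, hv⟩
  rw [hTempty, Set.ncard_empty, Nat.cast_zero] at hmain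
  have hfirst : (H.card : ℝ) ≤ ((k : ℝ) - 1) * ((r : ℝ) - 1) / (r : ℝ) * shadow.card := by
    rw [div_mul_eq_mul_div, le_div_iff₀ hr0]
    linarith
  refine ⟨hfirst, hfirst.trans (mul_le_mul_of_nonneg_left hchoose ?_)⟩
  have hk' : (1 : ℝ) ≤ k := by exact_mod_cast hk1
  have hr' : (2 : ℝ) ≤ r := by exact_mod_cast hr
  exact div_nonneg (mul_nonneg (by linarith) (by linarith)) hr0.le
end

section
/- For all integers n > r > 1, ex_↻(n, M_2^r) = C(n, r) − C(n − r, r). -/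
/-- `IsCycCrossMatching r k H v` says that the distinct vertices
`v 0 < v 1 < ... < v (r*k-1)` (in the clockwise cyclic order on `Fin n`) carry a crossing
`k`-matching `M_k^r` in `H`: the `k` pairwise disjoint edges
`{v i, v (i+k), v (i+2k), ..., v (i+(r-1)k)}` for `0 ≤ i ≤ k-1` all belong to `H`. -/
def IsCycCrossMatching (r k : ℕ) {n : ℕ} (H : Finset (Finset (Fin n))) (v : ℕ → Fin n) : Prop :=
  CycChain (r * k) v ∧
  ∀ i : ℕ, i < k → Finset.image (fun j => v (i + j * k)) (Finset.range r) ∈ H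

/-- `IsOrdCrossMatching r k H v` says that the distinct vertices
`v 0 < v 1 < ... < v (r*k-1)` (in the linear order on `Fin n`) carry a crossing
`k`-matching `M_k^r` in `H`: the `k` pairwise disjoint edges
`{v i, v (i+k), v (i+2k), ..., v (i+(r-1)k)}` for `0 ≤ i ≤ k-1` all belong to `H`. -/
def IsOrdCrossMatching (r k : ℕ) {n : ℕ} (H : Finset (Finset (Fin n))) (v : ℕ → Fin n) : Prop :=
  (∀ i j : ℕ, i < j → j < r * k → v i < v j) ∧
  ∀ i : ℕ, i < k → Finset.image (fun j => v (i + j * k)) (Finset.range r) ∈ H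

/-- `exCycM n r k` is the maximum number of edges in an `n`-vertex convex geometric `r`-graph
containing no crossing `k`-matching `M_k^r`. -/
noncomputable def exCycM (n r k : ℕ) : ℕ :=
  sSup {m | ∃ H : Finset (Finset (Fin n)),
    (∀ e ∈ H, e.card = r) ∧ (¬ ∃ v : ℕ → Fin n, IsCycCrossMatching r k H v) ∧ H.card = m}

/-- `exOrdM n r k` is the maximum number of edges in an `n`-vertex ordered `r`-graph
containing no crossing `k`-matching `M_k^r`. -/
noncomputable def exOrdM (n r k : ℕ) : ℕ :=
  sSup {m | ∃ H : Finset (Finset (Fin n)),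
    (∀ e ∈ H, e.card = r) ∧ (¬ ∃ v : ℕ → Fin n, IsOrdCrossMatching r k H v) ∧ H.card = m}

/-- `OrdCrossFree r H` says that no two members of `H` interleave as
`v 0 < v 1 < ... < v (2*r-1)`, the even-indexed vertices forming one member and the
odd-indexed vertices the other. -/
def OrdCrossFree (r : ℕ) (H : Finset (Finset ℕ)) : Prop :=
  ∀ v : ℕ → ℕ, (∀ i j, i < j → j < 2 * r → v i < v j) →
    (Finset.range r).image (fun j => v (2 * j)) ∈ H →
    (Finset.range r).image (fun j => v (2 * j + 1)) ∉ H

/-- If every member of `G` extends by both `n` and `n + 1` to a member of a crossing-free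
family, then `G` is crossing-free. -/
theorem OrdCrossFree.of_insert {r n : ℕ} {H G : Finset (Finset ℕ)}
    (hH : OrdCrossFree (r + 1) H) (hG : ∀ x ∈ G, x ⊆ Finset.range n)
    (h0 : ∀ x ∈ G, insert n x ∈ H) (h1 : ∀ x ∈ G, insert (n + 1) x ∈ H) :
    OrdCrossFree r G := by
  intro v hv hx hy
  have hlt : ∀ i, i < 2 * r → v i < n := by
    intro i hi
    rcases Nat.even_or_odd' i with ⟨j, rfl | rfl⟩
    · exact Finset.mem_range.1 (hG _ hx (Finset.mem_image.2
        ⟨j, Finset.mem_range.2 (by omega), rfl⟩))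
    · exact Finset.mem_range.1 (hG _ hy (Finset.mem_image.2
        ⟨j, Finset.mem_range.2 (by omega), rfl⟩))
  refine hH (fun i => if i < 2 * r then v i else n + (i - 2 * r)) ?_ ?_ ?_
  · intro i j hij hj
    by_cases hi : i < 2 * r <;> by_cases hj' : j < 2 * r
    · simpa [hi, hj'] using hv i j hij hj'
    · have := hlt i hi
      simp only [hi, hj', if_true, if_false]
      omega
    · omega
    · simp only [hi, hj', if_false]
      omega
  · convert h0 _ hx using 1
    rw [Finset.range_add_one, Finset.image_insert]
    congr 1
    · simp
    · refine Finset.image_congr fun j hj => ?_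
      have : j < r := by simpa using hj
      simp [this]
  · convert h1 _ hy using 1
    rw [Finset.range_add_one, Finset.image_insert]
    congr 1
    · simp
    · refine Finset.image_congr fun j hj => ?_
      have : j < r := by simpa using hj
      have : 2 * j + 1 < 2 * r := by omega
      simp [this]

/-- Merging the last vertex `n + 1` into `n` preserves crossing-freeness. -/
theorem OrdCrossFree.merge {r n : ℕ} {H H₀ M : Finset (Finset ℕ)}
    (hH : OrdCrossFree (r + 1) H) (h0 : H₀ ⊆ H)
    (hsub : ∀ e ∈ H₀ ∪ M, e ⊆ Finset.range (n + 1))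
    (hM : ∀ e ∈ M, ∃ y, n ∉ y ∧ insert (n + 1) y ∈ H ∧ insert n y = e) :
    OrdCrossFree (r + 1) (H₀ ∪ M) := by
  intro v hv hP hQ
  have hlast : v (2 * r + 1) ≤ n := Nat.lt_succ_iff.1 (Finset.mem_range.1
    (hsub _ hQ (Finset.mem_image.2 ⟨r, by simp, rfl⟩)))
  have hlt : ∀ i, i < 2 * r + 1 → v i < n := fun i hi =>
    (hv i (2 * r + 1) hi (by omega)).trans_le hlast
  have hP' : (Finset.range (r + 1)).image (fun j => v (2 * j)) ∈ H := by
    rcases Finset.mem_union.1 hP with h | h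
    · exact h0 h
    · obtain ⟨y, -, -, hy⟩ := hM _ h
      have hn : n ∈ (Finset.range (r + 1)).image (fun j => v (2 * j)) :=
        hy ▸ Finset.mem_insert_self _ _
      obtain ⟨j, hj, hjn⟩ := Finset.mem_image.1 hn
      have hj := Finset.mem_range.1 hj
      have := hlt (2 * j) (by omega)
      omega
  rcases Finset.mem_union.1 hQ with h | h
  · exact hH v hv hP' (h0 h)
  · obtain ⟨y, hny, hyH, hy⟩ := hM _ h
    set Y := (Finset.range r).image (fun j => v (2 * j + 1)) with hY
    have hnY : n ∉ Y := by
      intro hn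
      obtain ⟨j, hj, hjn⟩ := Finset.mem_image.1 hn
      have hj := Finset.mem_range.1 hj
      have := hlt (2 * j + 1) (by omega)
      omega
    rw [Finset.range_add_one, Finset.image_insert, ← hY] at hy
    have hvn : v (2 * r + 1) = n := by
      have hn : n ∈ insert (v (2 * r + 1)) Y := hy ▸ Finset.mem_insert_self _ _
      rcases Finset.mem_insert.1 hn with h | h
      · exact h.symm
      · exact absurd h hnY
    have hyY : y = Y := by
      rw [hvn] at hy
      rw [← Finset.erase_insert hny, hy, Finset.erase_insert hnY]
    refine hH (Function.update v (2 * r + 1) (n + 1)) ?_ ?_ ?_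
    · intro i j hij hj
      have hi : i ≠ 2 * r + 1 := by omega
      rw [Function.update_of_ne hi]
      by_cases hj' : j = 2 * r + 1
      · subst hj'
        have := hlt i hij
        simp only [Function.update_self]
        omega
      · rw [Function.update_of_ne hj']
        exact hv i j hij hj
    · convert hP' using 1
      refine Finset.image_congr fun j _ => ?_
      exact Function.update_of_ne (by omega) _ _
    · convert hyH using 1
      rw [Finset.range_add_one, Finset.image_insert]
      congr 1
      · simp
      · rw [hyY, hY]
        refine Finset.image_congr fun j hj => ?_
        have : j < r := by simpa using hj
        exact Function.update_of_ne (by omega) _ _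

/-- A crossing-free family of `r`-subsets of `{0, ..., n-1}` has at most
`C(n, r) - C(n-r, r)` members. -/
theorem OrdCrossFree.card_add_choose_le (n : ℕ) : ∀ (r : ℕ) (H : Finset (Finset ℕ)),
    H ⊆ (Finset.range n).powersetCard r → OrdCrossFree r H →
      H.card + (n - r).choose r ≤ n.choose r := by
  induction n using Nat.strong_induction_on with
  | _ n ih =>
  intro r H hsub hH
  by_cases hnr : n < 2 * r
  · rw [Nat.choose_eq_zero_of_lt (show n - r < r by omega)]
    simpa using Finset.card_le_card hsub
  rcases r with _ | r
  · have : H = ∅ := by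
      refine Finset.eq_empty_of_forall_notMem fun e he => ?_
      have h0 : e = ∅ := by simpa using hsub he
      subst h0
      exact hH id (by simp) (by simpa using he) (by simpa using he)
    simp [this]
  obtain ⟨n, rfl⟩ : ∃ m, n = m + 2 := ⟨n - 2, by omega⟩
  have hmem : ∀ e ∈ H, e ⊆ Finset.range (n + 2) ∧ e.card = r + 1 := fun e he =>
    Finset.mem_powersetCard.1 (hsub he)
  set H₀ := H.filter (fun e => n + 1 ∉ e) with hH₀
  set H₁ := H.filter (fun e => n + 1 ∈ e) with hH₁
  set L := H₁.image (fun e => e.erase (n + 1)) with hL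
  set La := L.filter (fun x => n ∈ x) with hLa
  set Lb := L.filter (fun x => n ∉ x) with hLb
  set M := Lb.image (fun x => insert n x) with hM
  set G := Lb.filter (fun x => insert n x ∈ H₀) with hG
  have hLmem : ∀ x ∈ L, x ⊆ Finset.range (n + 1) ∧ x.card = r ∧ insert (n + 1) x ∈ H := by
    intro x hx
    obtain ⟨e, he, rfl⟩ := Finset.mem_image.1 hx
    obtain ⟨heH, hne⟩ := Finset.mem_filter.1 he
    obtain ⟨h1, h2⟩ := hmem e heH
    refine ⟨fun a ha => ?_, ?_, ?_⟩
    · have ha := Finset.mem_erase.1 ha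
      have := Finset.mem_range.1 (h1 ha.2)
      exact Finset.mem_range.2 (by omega)
    · rw [Finset.card_erase_of_mem hne, h2]; rfl
    · rwa [Finset.insert_erase hne]
  have hLbmem : ∀ x ∈ Lb, x ⊆ Finset.range n ∧ x.card = r ∧ insert (n + 1) x ∈ H ∧ n ∉ x := by
    intro x hx
    obtain ⟨hxL, hnx⟩ := Finset.mem_filter.1 hx
    obtain ⟨h1, h2, h3⟩ := hLmem x hxL
    refine ⟨fun a ha => ?_, h2, h3, hnx⟩
    have := Finset.mem_range.1 (h1 ha)
    have : a ≠ n := fun h => hnx (h ▸ ha)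
    exact Finset.mem_range.2 (by omega)
  have hcH : H.card = H₁.card + H₀.card :=
    (Finset.card_filter_add_card_filter_not (s := H) (fun e => n + 1 ∈ e)).symm
  have hcL : L.card = H₁.card := Finset.card_image_of_injOn fun a ha b hb hab => by
    have ha := (Finset.mem_filter.1 (Finset.mem_coe.1 ha)).2
    have hb := (Finset.mem_filter.1 (Finset.mem_coe.1 hb)).2
    rw [← Finset.insert_erase ha, ← Finset.insert_erase hb]
    exact congrArg _ hab
  have hcL' : L.card = La.card + Lb.card :=
    (Finset.card_filter_add_card_filter_not (s := L) (fun x => n ∈ x)).symm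
  have hcM : M.card = Lb.card := Finset.card_image_of_injOn fun a ha b hb hab => by
    have ha := (hLbmem a (Finset.mem_coe.1 ha)).2.2.2
    have hb := (hLbmem b (Finset.mem_coe.1 hb)).2.2.2
    rw [← Finset.erase_insert ha, ← Finset.erase_insert hb]
    exact congrArg (fun s => s.erase n) hab
  have hcU := Finset.card_union_add_card_inter H₀ M
  have hcI : (H₀ ∩ M).card ≤ G.card := by
    refine (Finset.card_le_card ?_).trans
      (Finset.card_image_le (s := G) (f := fun x => insert n x))
    intro e he
    obtain ⟨he0, heM⟩ := Finset.mem_inter.1 he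
    obtain ⟨x, hx, rfl⟩ := Finset.mem_image.1 heM
    exact Finset.mem_image.2 ⟨x, Finset.mem_filter.2 ⟨hx, he0⟩, rfl⟩
  have hUsub : H₀ ∪ M ⊆ (Finset.range (n + 1)).powersetCard (r + 1) := by
    intro e he
    rw [Finset.mem_powersetCard]
    rcases Finset.mem_union.1 he with h | h
    · obtain ⟨heH, hne⟩ := Finset.mem_filter.1 h
      obtain ⟨h1, h2⟩ := hmem e heH
      refine ⟨fun a ha => ?_, h2⟩
      have := Finset.mem_range.1 (h1 ha)
      have : a ≠ n + 1 := fun h => hne (h ▸ ha)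
      exact Finset.mem_range.2 (by omega)
    · obtain ⟨x, hx, rfl⟩ := Finset.mem_image.1 h
      obtain ⟨h1, h2, -, h4⟩ := hLbmem x hx
      refine ⟨Finset.insert_subset (by simp) (h1.trans ?_), ?_⟩
      · exact Finset.range_subset_range.2 (by omega)
      · rw [Finset.card_insert_of_notMem h4, h2]
  have ihU := ih (n + 1) (by omega) (r + 1) (H₀ ∪ M) hUsub <|
    hH.merge (n := n) (Finset.filter_subset _ _)
      (fun e he => (Finset.mem_powersetCard.1 (hUsub he)).1)
      (fun e he => by
        obtain ⟨x, hx, rfl⟩ := Finset.mem_image.1 he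
        exact ⟨x, (hLbmem x hx).2.2.2, (hLbmem x hx).2.2.1, rfl⟩)
  have hGLb : ∀ x ∈ G, x ∈ Lb := fun x hx => (Finset.mem_filter.1 hx).1
  have ihG := ih n (by omega) r G
    (fun x hx => Finset.mem_powersetCard.2
      ⟨(hLbmem x (hGLb x hx)).1, (hLbmem x (hGLb x hx)).2.1⟩) <|
    hH.of_insert (fun x hx => (hLbmem x (hGLb x hx)).1)
      (fun x hx => (Finset.mem_filter.1 (Finset.mem_filter.1 hx).2).1)
      (fun x hx => (hLbmem x (hGLb x hx)).2.2.1)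
  have hcLa : La.card + n.choose r ≤ (n + 1).choose r := by
    have hd : Disjoint La ((Finset.range n).powersetCard r) := by
      rw [Finset.disjoint_left]
      intro x hx hx'
      have := (Finset.mem_powersetCard.1 hx').1 (Finset.mem_filter.1 hx).2
      simp at this
    have hs : La ∪ (Finset.range n).powersetCard r ⊆ (Finset.range (n + 1)).powersetCard r := by
      refine Finset.union_subset (fun x hx => ?_) (Finset.powersetCard_mono ?_)
      · have := hLmem x (Finset.mem_filter.1 hx).1
        exact Finset.mem_powersetCard.2 ⟨this.1, this.2.1⟩
      · exact Finset.range_subset_range.2 (by omega)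
    have := Finset.card_le_card hs
    rw [Finset.card_union_of_disjoint hd] at this
    simpa using this
  have e1 : n + 2 - (r + 1) = (n - r) + 1 := by omega
  have e2 : n + 1 - (r + 1) = n - r := by omega
  rw [e1, Nat.choose_succ_succ, Nat.choose_succ_succ (n + 1)]
  rw [e2] at ihU
  simp only [Nat.succ_eq_add_one] at *
  omega

/-- There are at most `C(m+1-r, r)` subsets of `{0, ..., m-1}` of size `r` without two
consecutive elements. -/
theorem card_powersetCard_filter_sparse_le (m : ℕ) : ∀ r : ℕ,
    (((Finset.range m).powersetCard r).filter (fun e => ∀ x ∈ e, x + 1 ∉ e)).card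
      ≤ (m + 1 - r).choose r := by
  induction m using Nat.strong_induction_on with
  | _ m ih =>
  intro r
  rcases r with _ | r
  · exact (Finset.card_filter_le _ _).trans (by simp)
  rcases m with _ | _ | m
  · simp
  · refine (Finset.card_filter_le _ _).trans ?_
    rcases r with _ | r
    · simp
    · simp [Nat.choose_eq_zero_of_lt (show 1 < r + 1 + 1 by omega)]
  have ih1 := ih (m + 1) (by omega) (r + 1)
  have ih0 := ih m (by omega) r
  set S := ((Finset.range (m + 2)).powersetCard (r + 1)).filter
    (fun e => ∀ x ∈ e, x + 1 ∉ e) with hS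
  have hc : S.card = _ :=
    (Finset.card_filter_add_card_filter_not (s := S) (fun e => m + 1 ∈ e)).symm
  have h1 : (S.filter (fun e => m + 1 ∉ e)).card ≤ (m + 1 + 1 - (r + 1)).choose (r + 1) := by
    refine (Finset.card_le_card fun e he => ?_).trans ih1
    simp only [hS, Finset.mem_filter, Finset.mem_powersetCard] at he ⊢
    obtain ⟨⟨⟨h1, h2⟩, h3⟩, h4⟩ := he
    refine ⟨⟨fun a ha => ?_, h2⟩, h3⟩
    have := Finset.mem_range.1 (h1 ha)
    have : a ≠ m + 1 := fun h => h4 (h ▸ ha)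
    exact Finset.mem_range.2 (by omega)
  have h0 : (S.filter (fun e => m + 1 ∈ e)).card ≤ (m + 1 - r).choose r := by
    refine (Finset.card_le_card_of_injOn (fun e => e.erase (m + 1)) ?_ ?_).trans ih0
    · intro e he
      simp only [hS, Finset.coe_filter, Finset.mem_filter, Finset.mem_powersetCard,
        Set.mem_ofPred_eq] at he ⊢
      obtain ⟨⟨⟨h1, h2⟩, h3⟩, h4⟩ := he
      refine ⟨⟨fun a ha => ?_, ?_⟩, fun x hx hx' => ?_⟩
      · have ha := Finset.mem_erase.1 ha
        have := Finset.mem_range.1 (h1 ha.2)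
        have : a ≠ m := fun h => h3 a ha.2 (h ▸ h4)
        exact Finset.mem_range.2 (by omega)
      · rw [Finset.card_erase_of_mem h4, h2]; rfl
      · exact h3 x (Finset.mem_of_mem_erase hx) (Finset.mem_of_mem_erase hx')
    · intro a ha b hb hab
      have ha := (Finset.mem_filter.1 (Finset.mem_coe.1 ha)).2
      have hb := (Finset.mem_filter.1 (Finset.mem_coe.1 hb)).2
      rw [← Finset.insert_erase ha, ← Finset.insert_erase hb]
      exact congrArg _ hab
  have hp : (m + 1 - r).choose r + (m + 1 + 1 - (r + 1)).choose (r + 1)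
      ≤ (m + 2 + 1 - (r + 1)).choose (r + 1) := by
    rcases Nat.lt_or_ge (m + 1) r with h | h
    · have e : m + 1 - r = 0 := by omega
      have e' : m + 1 + 1 - (r + 1) = 0 := by omega
      rw [e, e', Nat.choose_eq_zero_of_lt (show 0 < r by omega)]
      simp
    · have e : m + 2 + 1 - (r + 1) = (m + 1 - r) + 1 := by omega
      have e' : m + 1 + 1 - (r + 1) = m + 1 - r := by omega
      rw [e, e', Nat.choose_succ_succ]
  change S.card ≤ (m + 2 + 1 - (r + 1)).choose (r + 1)
  omega

/-- A strictly increasing sequence in `Fin n` is a chain in the cyclic order. -/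
theorem cycChain_of_lt {n ℓ : ℕ} {w : ℕ → Fin n}
    (hw : ∀ i j, i < j → j < ℓ → w i < w j) : CycChain ℓ w := by
  intro i j hij hj
  have h0 : w 0 ≤ w i := by
    rcases Nat.eq_zero_or_pos i with rfl | hi
    · exact le_rfl
    · exact (hw 0 i hi (by omega)).le
  have hij' := hw i j hij hj
  rw [Fin.lt_def, Fin.sub_val_of_le h0, Fin.sub_val_of_le (h0.trans hij'.le)]
  rw [Fin.lt_def] at hij'
  rw [Fin.le_def] at h0
  omega

/-- The positions of two cyclically consecutive vertices in a chain of even length differ in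
parity. -/
theorem CycChain.mod_two_ne {m r i j : ℕ} {v : ℕ → Fin (m + 1)} (hv : CycChain (r * 2) v)
    (hi : i < r * 2) (hj : j < r * 2) (hij : v j = v i + 1) (hm : 0 < m) :
    i % 2 ≠ j % 2 := by
  intro hpar
  have hsub : v j - v 0 = (v i - v 0) + 1 := by rw [hij]; abel
  have hne : i ≠ j := by
    rintro rfl
    have h1 : (1 : Fin (m + 1)) = 0 := by simpa using hij.symm
    have h2 := congrArg Fin.val h1
    rw [Fin.val_one', Nat.mod_eq_of_lt (by omega)] at h2
    simp at h2
  rcases eq_or_ne (v i - v 0) (Fin.last m) with hl | hl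
  · have hi' : i + 1 = r * 2 := by
      by_contra h
      have := hv i (i + 1) (by omega) (by omega)
      rw [hl] at this
      exact absurd this (Fin.le_last _).not_gt
    have hj0 : 0 < j := by omega
    have := hv 0 j hj0 hj
    rw [hsub, hl, Fin.last_add_one] at this
    simp at this
  · have hval : (v j - v 0).val = (v i - v 0).val + 1 := by
      rw [hsub, Fin.val_add_one, if_neg hl]
    rcases Nat.lt_or_ge i j with h | h
    · have h1 := Fin.lt_def.1 (hv i (i + 1) (by omega) (by omega))
      have h2 := Fin.lt_def.1 (hv (i + 1) j (by omega) (by omega))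
      omega
    · have h1 := Fin.lt_def.1 (hv j i (by omega) (by omega))
      omega

/-- An upper bound on crossing-free convex geometric hypergraphs. -/
theorem card_le_of_not_isCycCrossMatching {r n : ℕ} (H : Finset (Finset (Fin n)))
    (hr : 0 < r) (hcard : ∀ e ∈ H, e.card = r)
    (hH : ¬ ∃ v : ℕ → Fin n, IsCycCrossMatching r 2 H v) :
    H.card ≤ n.choose r - (n - r).choose r := by
  refine Nat.le_sub_of_add_le ?_
  let f : Finset (Fin n) ↪ Finset ℕ := (Finset.mapEmbedding Fin.valEmbedding).toEmbedding
  rw [← Finset.card_map f]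
  refine OrdCrossFree.card_add_choose_le n r _ ?_ ?_
  · intro e he
    obtain ⟨x, hx, rfl⟩ := Finset.mem_map.1 he
    refine Finset.mem_powersetCard.2 ⟨fun a ha => ?_, ?_⟩
    · obtain ⟨b, -, rfl⟩ := Finset.mem_map.1 (show a ∈ x.map Fin.valEmbedding from ha)
      exact Finset.mem_range.2 b.2
    · exact (Finset.card_map _).trans (hcard x hx)
  · intro v hv hP hQ
    obtain ⟨p, hp, hpP⟩ := Finset.mem_map.1 hP
    obtain ⟨q, hq, hqQ⟩ := Finset.mem_map.1 hQ
    change p.map Fin.valEmbedding = _ at hpP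
    change q.map Fin.valEmbedding = _ at hqQ
    have hlt : ∀ i, i < 2 * r → v i < n := by
      intro i hi
      rcases Nat.even_or_odd' i with ⟨j, rfl | rfl⟩
      · have : v (2 * j) ∈ p.map Fin.valEmbedding := by
          rw [hpP]; exact Finset.mem_image.2 ⟨j, Finset.mem_range.2 (by omega), rfl⟩
        obtain ⟨b, -, hb⟩ := Finset.mem_map.1 this
        exact hb ▸ b.2
      · have : v (2 * j + 1) ∈ q.map Fin.valEmbedding := by
          rw [hqQ]; exact Finset.mem_image.2 ⟨j, Finset.mem_range.2 (by omega), rfl⟩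
        obtain ⟨b, -, hb⟩ := Finset.mem_map.1 this
        exact hb ▸ b.2
    have hn : 0 < n := (Nat.zero_le _).trans_lt (hlt 0 (by omega))
    let w : ℕ → Fin n := fun i => if h : v i < n then ⟨v i, h⟩ else ⟨0, hn⟩
    have hw : ∀ i, i < 2 * r → (w i).val = v i := fun i hi => by simp [w, hlt i hi]
    refine hH ⟨w, cycChain_of_lt fun i j hij hj => ?_, fun i hi => ?_⟩
    · rw [Fin.lt_def, hw i (by omega), hw j (by omega)]
      exact hv i j hij (by omega)
    · have key : ∀ s : Finset (Fin n), s.map Fin.valEmbedding =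
          (Finset.range r).image (fun j => v (2 * j + i)) →
          (Finset.range r).image (fun j => w (i + j * 2)) = s := by
        intro s hs
        refine Finset.map_injective Fin.valEmbedding ?_
        rw [hs, Finset.map_eq_image, Finset.image_image]
        refine Finset.image_congr fun j hj => ?_
        have hj : j < r := by simpa using hj
        have := hw (i + j * 2) (by omega)
        have e : 2 * j + i = i + j * 2 := by ring
        simpa [e] using this
      interval_cases i
      · rw [key p (by simpa using hpP)]; exact hp
      · rw [key q hqQ]; exact hq

/-- The edges containing the last vertex or two cyclically consecutive vertices form a
crossing-free convex geometric hypergraph attaining the bound. -/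
theorem exists_not_isCycCrossMatching_le_card (r m : ℕ) (hm : 0 < m) :
    ∃ H : Finset (Finset (Fin (m + 1))), (∀ e ∈ H, e.card = r) ∧
      (¬ ∃ v : ℕ → Fin (m + 1), IsCycCrossMatching r 2 H v) ∧
      (m + 1).choose r - (m + 1 - r).choose r ≤ H.card := by
  classical
  let U := (Finset.univ : Finset (Fin (m + 1))).powersetCard r
  let p : Finset (Fin (m + 1)) → Prop := fun e => Fin.last m ∈ e ∨ ∃ x ∈ e, x + 1 ∈ e
  refine ⟨U.filter p, fun e he => ?_, ?_, ?_⟩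
  · exact (Finset.mem_powersetCard.1 (Finset.mem_filter.1 he).1).2
  · rintro ⟨v, hv, hE⟩
    have hlast : ∀ i < 2, ∃ j, j < r * 2 ∧ j % 2 = i ∧ v j = Fin.last m := by
      intro i hi
      rcases (Finset.mem_filter.1 (hE i hi)).2 with h | ⟨x, hx, hx'⟩
      · obtain ⟨j, hj, hjv⟩ := Finset.mem_image.1 h
        have hj := Finset.mem_range.1 hj
        exact ⟨i + j * 2, by omega, by omega, hjv⟩
      · obtain ⟨a, ha, rfl⟩ := Finset.mem_image.1 hx
        obtain ⟨b, hb, hab⟩ := Finset.mem_image.1 hx'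
        have ha := Finset.mem_range.1 ha
        have hb := Finset.mem_range.1 hb
        exact absurd (show (i + a * 2) % 2 = (i + b * 2) % 2 by omega)
          (hv.mod_two_ne (by omega) (by omega) hab hm)
    obtain ⟨a, ha, ha2, hav⟩ := hlast 0 (by omega)
    obtain ⟨b, hb, hb2, hbv⟩ := hlast 1 (by omega)
    rcases lt_trichotomy a b with h | h | h
    · have := hv a b h hb
      rw [hav, hbv] at this
      exact lt_irrefl _ this
    · omega
    · have := hv b a h ha
      rw [hav, hbv] at this
      exact lt_irrefl _ this
  · have hU : U.card = (m + 1).choose r := by simp [U]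
    have hc := Finset.card_filter_add_card_filter_not (s := U) p
    have hle : (U.filter (fun e => ¬ p e)).card ≤ (m + 1 - r).choose r := by
      refine (Finset.card_le_card_of_injOn (fun e => e.map Fin.valEmbedding) ?_
        (Finset.map_injective _).injOn).trans (card_powersetCard_filter_sparse_le m r)
      intro e he
      obtain ⟨heU, hp⟩ := Finset.mem_filter.1 (Finset.mem_coe.1 he)
      have hcard := (Finset.mem_powersetCard.1 heU).2
      simp only [p, not_or, not_exists, not_and] at hp
      have hlt : ∀ b ∈ e, b.val < m := fun b hb => by
        have : b ≠ Fin.last m := fun h => hp.1 (h ▸ hb)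
        exact Fin.val_lt_last this
      refine Finset.mem_coe.2 (Finset.mem_filter.2
        ⟨Finset.mem_powersetCard.2 ⟨fun a ha => ?_, ?_⟩, fun x hx hx' => ?_⟩)
      · obtain ⟨b, hb, rfl⟩ := Finset.mem_map.1 ha
        exact Finset.mem_range.2 (hlt b hb)
      · rw [Finset.card_map, hcard]
      · obtain ⟨a, ha, rfl⟩ := Finset.mem_map.1 hx
        obtain ⟨b, hb, hab⟩ := Finset.mem_map.1 hx'
        refine hp.2 a ha ?_
        have hne : a ≠ Fin.last m := fun h => hp.1 (h ▸ ha)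
        have : a + 1 = b := by
          refine Fin.ext ?_
          rw [Fin.val_add_one, if_neg hne]
          exact hab.symm
        rwa [this]
    omega

/-- For all `n > r > 1`, `ex_↻(n, M_2^r) = C(n,r) − C(n−r,r)`. -/
theorem stmt16 (r n : ℕ) (hr : 1 < r) (hn : r < n) :
    exCycM n r 2 = n.choose r - (n - r).choose r := by
  obtain ⟨m, rfl⟩ : ∃ m, n = m + 1 := ⟨n - 1, by omega⟩
  obtain ⟨H, hcard, hfree, hle⟩ := exists_not_isCycCrossMatching_le_card r m (by omega)
  refine IsGreatest.csSup_eq ⟨⟨H, hcard, hfree, le_antisymm ?_ hle⟩, ?_⟩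
  · exact card_le_of_not_isCycCrossMatching H (by omega) hcard hfree
  · rintro _ ⟨H', hcard', hfree', rfl⟩
    exact card_le_of_not_isCycCrossMatching H' (by omega) hcard' hfree'
end
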